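/- Let (s_{0,0}, …, s_{0,m}) = N(σ_0, …, σ_m) be a Nikishin system, n ∈ ℤ₊^{m+1}, and let Q_n be a type II polynomial with associated polynomials P_{n,k}. Then Q_n has exactly |n| zeros, all simple and lying in the interior of Co(supp σ_0); denote them x_{n,1}, …, x_{n,|n|} and set λ_{n,k,i} := P_{n,k}(x_{n,i})/Q_n'(x_{n,i}). Then for each k = 0, …, m and every polynomial p with deg p ≤ |n| + n_k − 1 one has ∫ p(x) ds_{0,k}(x) = Σ_{i=1}^{|n|} λ_{n,k,i}·p(x_{n,i}). -/

import Mathlib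

open MeasureTheory Set Polynomial Filter

noncomputable section

/-- A signed Borel measure on `ℝ`, represented by a pair of (nonnegative) measures
(a "positive part" and a "negative part"). -/
structure SignedM where
  pos : MeasureTheory.Measure ℝ
  neg : MeasureTheory.Measure ℝ

namespace SignedM

/-- Integral of a complex-valued function against a signed measure. -/
def cintegral (s : SignedM) (f : ℝ → ℂ) : ℂ :=
  (∫ x, f x ∂s.pos) - ∫ x, f x ∂s.neg

/-- Integral of a real-valued function against a signed measure. -/
def rintegral (s : SignedM) (f : ℝ → ℝ) : ℝ :=
  (∫ x, f x ∂s.pos) - ∫ x, f x ∂s.neg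

/-- The Cauchy transform `ŝ(z) = ∫ ds(x)/(z - x)` at a complex point. -/
def cauchy (s : SignedM) (z : ℂ) : ℂ :=
  s.cintegral fun x => (z - (x : ℂ))⁻¹

/-- The Cauchy transform at a real point (real-valued). -/
def cauchyR (s : SignedM) (x : ℝ) : ℝ :=
  s.rintegral fun t => (x - t)⁻¹

/-- The total variation `|s|` (for the constant-sign representation used here). -/
def mass (s : SignedM) : ℝ :=
  (s.pos Set.univ).toReal + (s.neg Set.univ).toReal

/-- The (topological) support of a nonnegative measure. -/
def msupport (μ : MeasureTheory.Measure ℝ) : Set ℝ :=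
  {x | ∀ U : Set ℝ, IsOpen U → x ∈ U → μ U ≠ 0}

/-- The support of a signed measure. -/
def supp (s : SignedM) : Set ℝ := msupport s.pos ∪ msupport s.neg

/-- The signed measure `g·s` with (real, possibly sign-changing) density `g` w.r.t. `s`. -/
def withDensityR (s : SignedM) (g : ℝ → ℝ) : SignedM where
  pos := s.pos.withDensity (fun x => ENNReal.ofReal (g x)) +
    s.neg.withDensity (fun x => ENNReal.ofReal (-g x))
  neg := s.pos.withDensity (fun x => ENNReal.ofReal (-g x)) +
    s.neg.withDensity (fun x => ENNReal.ofReal (g x))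

/-- The product `⟨a, b⟩`: the measure with density `b̂` with respect to `a`. -/
def nik (a b : SignedM) : SignedM := a.withDensityR b.cauchyR

end SignedM

/-- `s ∈ M(Δ)`: a finite Borel measure with constant sign, whose support is compact and
consists of infinitely many points, `Δ` being the smallest closed interval containing it. -/
structure IsM (s : SignedM) (Δ : Set ℝ) : Prop where
  posFinite : MeasureTheory.IsFiniteMeasure s.pos
  negFinite : MeasureTheory.IsFiniteMeasure s.neg
  constSign : s.pos = 0 ∨ s.neg = 0
  compactSupp : IsCompact s.supp
  infiniteSupp : s.supp.Infinite
  hullEq : Δ = Set.Icc (sInf s.supp) (sSup s.supp)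

/-- A set of reals, viewed inside `ℂ`. -/
def cSet (Δ : Set ℝ) : Set ℂ := (fun x : ℝ => (x : ℂ)) '' Δ

/-- `τ` is the inverse measure of `s`: `1/ŝ(z) = z/|s| + b + τ̂(z)` on `ℂ ∖ Δ`. -/
def IsInverse (s τ : SignedM) (Δ : Set ℝ) : Prop :=
  ∃ b : ℝ, ∀ z : ℂ, z ∉ cSet Δ →
    (s.cauchy z)⁻¹ = z / (s.mass : ℂ) + (b : ℂ) + τ.cauchy z

/-- The iterated products `s_{j,k} = ⟨σ_j, σ_{j+1}, …, σ_k⟩` of a Nikishin system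
(`s_{j,k} = σ_j` when `j ≥ k`). -/
def nikSys (σ : ℕ → SignedM) : ℕ → ℕ → SignedM
  | j, k => if h : j < k then (σ j).nik (nikSys σ (j + 1) k) else σ j
  termination_by j k => k - j
  decreasing_by omega

/-- `Q` is a type II polynomial for the Nikishin system `N(σ₀, …, σ_m)` and the
multi-index `n`, with associated polynomials `P k`:  `Q ≠ 0`, `deg Q ≤ |n|` and
`Q·ŝ_{0,k} − P_k = O(1/z^{n_k+1})` as `z → ∞` for every `k ≤ m`. -/
def IsTypeII (σ : ℕ → SignedM) (m : ℕ) (n : ℕ → ℕ) (Q : Polynomial ℝ)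
    (P : ℕ → Polynomial ℝ) : Prop :=
  Q ≠ 0 ∧ Q.degree ≤ ((∑ j ∈ Finset.range (m + 1), n j : ℕ) : WithBot ℕ) ∧
  ∀ k ≤ m, ∃ C R : ℝ, ∀ z : ℂ, R ≤ ‖z‖ →
    ‖aeval z Q * (nikSys σ 0 k).cauchy z - aeval z (P k)‖ ≤ C / ‖z‖ ^ (n k + 1)

open scoped Topology

/-- `g` does not vanish on `s` and has a constant sign there. -/
def SameSign (s : Set ℝ) (g : ℝ → ℝ) : Prop := ∃ e : ℝ, ∀ x ∈ s, 0 < e * g x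

/-- Plücker relation between minors of sizes `r + 1` and `r + 2`. -/
theorem det_pluecker {R ι : Type*} [CommRing R] [IsDomain R] {r : ℕ} (f : Fin (r + 2) → ι → R)
    (c : Fin r → ι) (a b j : ι) :
    (Matrix.of fun i k : Fin (r + 1) => f i.succ (Matrix.vecCons b c k)).det *
        (Matrix.of fun i k : Fin (r + 2) => f i (Matrix.vecCons j (Matrix.vecCons a c) k)).det -
      (Matrix.of fun i k : Fin (r + 1) => f i.succ (Matrix.vecCons j c k)).det *
        (Matrix.of fun i k : Fin (r + 2) => f i (Matrix.vecCons b (Matrix.vecCons a c) k)).det =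
      (Matrix.of fun i k : Fin (r + 1) => f i.succ (Matrix.vecCons a c k)).det *
        (Matrix.of fun i k : Fin (r + 2) => f i (Matrix.vecCons j (Matrix.vecCons b c) k)).det := by
  set φ : ι → R := fun x => (Matrix.of fun i k : Fin (r + 1) => f i.succ (Matrix.vecCons x c k)).det with hφ
  set col : Fin (r + 3) → ι := Matrix.vecCons j (Matrix.vecCons b (Matrix.vecCons a c))
    with hcol
  set M : Matrix (Fin (r + 3)) (Fin (r + 3)) R :=
    Matrix.of fun i k => (Matrix.vecCons (φ (col k)) (fun i' => f i' (col k))) i with hM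
  have hφc : ∀ k, φ (c k) = 0 := by
    intro k
    refine Matrix.det_zero_of_column_eq (i := 0) (j := k.succ) (Fin.succ_ne_zero k).symm ?_
    intro i
    simp
  obtain ⟨g, hg⟩ : ∃ g : Fin (r + 1) → R, ∀ x, φ x = ∑ i, g i * f i.succ x := by
    refine ⟨fun i => (-1) ^ (i : ℕ) *
      (Matrix.of fun (i' k : Fin r) => f (i.succAbove i').succ (c k)).det, fun x => ?_⟩
    rw [hφ]
    simp only
    rw [Matrix.det_succ_column_zero]
    refine Finset.sum_congr rfl fun i _ => ?_
    simp only [Matrix.of_apply, Matrix.cons_val_zero]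
    have : (Matrix.of fun i k : Fin (r + 1) => f i.succ (Matrix.vecCons x c k)).submatrix i.succAbove Fin.succ =
        (Matrix.of fun (i' k : Fin r) => f (i.succAbove i').succ (c k)) := by
      ext i' k; simp
    rw [this]; ring
  have hdet : M.det = 0 := by
    rw [← Matrix.exists_vecMul_eq_zero_iff]
    refine ⟨Matrix.vecCons 1 (Matrix.vecCons 0 (fun i => - g i)), ?_, ?_⟩
    · intro h
      have := congrFun h 0
      simp at this
    · ext k
      simp [Matrix.vecMul, dotProduct, Fin.sum_univ_succ, hM, hg]
  rw [Matrix.det_succ_row_zero] at hdet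
  rw [Fin.sum_univ_succ, Fin.sum_univ_succ, Fin.sum_univ_succ, Finset.sum_eq_zero (s := Finset.univ) (f := fun i : Fin r => _)] at hdet
  · have e0 : M.submatrix Fin.succ (Fin.succAbove 0) =
        Matrix.of fun i k : Fin (r + 2) => f i (Matrix.vecCons b (Matrix.vecCons a c) k) := by
      ext i k; simp [hM, hcol]
    have e1 : M.submatrix Fin.succ (Fin.succAbove (Fin.succ 0)) =
        Matrix.of fun i k : Fin (r + 2) => f i (Matrix.vecCons j (Matrix.vecCons a c) k) := by
      ext i k; refine Fin.cases ?_ (fun k => ?_) k <;> simp [hM, hcol]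
    have e2 : M.submatrix Fin.succ (Fin.succAbove (Fin.succ (Fin.succ 0))) =
        Matrix.of fun i k : Fin (r + 2) => f i (Matrix.vecCons j (Matrix.vecCons b c) k) := by
      ext i k; refine Fin.cases ?_ (fun k => Fin.cases ?_ (fun k => ?_) k) k <;>
        simp only [hM, hcol, Matrix.submatrix_apply, Matrix.of_apply, Fin.succ_succAbove_zero, Fin.succ_succAbove_succ,
          Fin.succAbove_zero, Matrix.cons_val_zero, Matrix.cons_val_succ]
    rw [e0, e1, e2] at hdet
    have m0 : M 0 0 = φ j := by simp [hM, hcol]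
    have m1 : M 0 (Fin.succ 0) = φ b := by simp [hM, hcol]
    have m2 : M 0 (Fin.succ (Fin.succ 0)) = φ a := by simp [hM, hcol]
    rw [m0, m1, m2] at hdet
    simp only [Fin.val_zero, pow_zero, Fin.val_succ, zero_add, pow_one, add_zero] at hdet
    linear_combination -hdet
  · intro i _
    have : M 0 i.succ.succ.succ = 0 := by simp [hM, hcol, hφc]
    rw [this]; ring

/-- The minor of the array `f` with columns `l` and rows `l.length - 1, …, 1, 0`. -/
def minor {R : Type*} [CommRing R] (f : ℕ → ℕ → R) (l : List ℕ) : R :=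
  (Matrix.of fun i k : Fin l.length => f (l.length - 1 - i) (l.getD k 0)).det

section Minor

variable {R : Type*} [CommRing R] (f : ℕ → ℕ → R)

theorem minor_nil : minor f [] = 1 := by
  simp [minor]

theorem minor_cons (b : ℕ) (l : List ℕ) :
    minor f (b :: l) = (Matrix.of fun i k : Fin (l.length + 1) =>
      f (l.length - i) (Matrix.vecCons b (fun k : Fin l.length => l.getD k 0) k)).det := by
  unfold minor
  congr 1
  ext i k
  simp only [List.length_cons, Matrix.of_apply, Nat.add_sub_cancel]
  congr 1
  refine Fin.cases ?_ (fun k => ?_) k <;> simp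

theorem minor_cons_cons (b a : ℕ) (l : List ℕ) :
    minor f (b :: a :: l) = (Matrix.of fun i k : Fin (l.length + 2) =>
      f (l.length + 1 - i)
        (Matrix.vecCons b (Matrix.vecCons a (fun k : Fin l.length => l.getD k 0)) k)).det := by
  rw [minor_cons]
  congr 1
  ext i k
  simp only [List.length_cons, Matrix.of_apply]
  congr 1
  refine Fin.cases ?_ (fun k => Fin.cases ?_ (fun k => ?_) k) k <;> simp

theorem minor_pluecker [IsDomain R] (a b j : ℕ) (l : List ℕ) :
    minor f (b :: l) * minor f (j :: a :: l) - minor f (j :: l) * minor f (b :: a :: l) =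
      minor f (a :: l) * minor f (j :: b :: l) := by
  have h := det_pluecker (fun (i : Fin (l.length + 2)) k => f (l.length + 1 - i) k)
    (fun k : Fin l.length => l.getD k 0) a b j
  simp only [minor_cons_cons]
  simpa [minor_cons, Nat.add_sub_add_right] using h

theorem minor_eq_zero_of_mem {j : ℕ} {l : List ℕ} (h : j ∈ l) : minor f (j :: l) = 0 := by
  rw [minor_cons]
  obtain ⟨k, hk, rfl⟩ := List.getElem_of_mem h
  refine Matrix.det_zero_of_column_eq (i := 0) (j := Fin.succ ⟨k, hk⟩) (Fin.succ_ne_zero _).symm ?_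
  intro i
  simp [List.getD_eq_getElem?_getD]

theorem minor_swap (pre l : List ℕ) (x y : ℕ) :
    minor f (pre ++ x :: y :: l) = -minor f (pre ++ y :: x :: l) := by
  set L := pre ++ y :: x :: l with hL
  have h1 : pre.length < L.length := by simp [hL]
  have h2 : pre.length + 1 < L.length := by simp [hL]
  have hlen : (pre ++ x :: y :: l).length = L.length := by simp [hL]
  have : minor f (pre ++ x :: y :: l) =
      ((Matrix.of fun i k : Fin L.length => f (L.length - 1 - i) (L.getD k 0)).submatrix id
        (Equiv.swap (⟨pre.length, h1⟩ : Fin L.length) ⟨pre.length + 1, h2⟩)).det := by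
    have gen : ∀ r, r = L.length → minor f (pre ++ x :: y :: l) =
      (Matrix.of fun i k : Fin r => f (r - 1 - i) ((pre ++ x :: y :: l).getD k 0)).det := by
      rintro r hr
      rw [← hlen] at hr
      subst hr
      rfl
    rw [gen _ rfl]
    congr 1
    ext i k
    simp only [Matrix.of_apply, Matrix.submatrix_apply, id]
    congr 1
    by_cases e1 : k = ⟨pre.length, h1⟩
    · subst e1
      simp [hL, List.getD_eq_getElem?_getD]
    by_cases e2 : k = ⟨pre.length + 1, h2⟩
    · subst e2
      simp [hL, List.getD_eq_getElem?_getD]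
    rw [Equiv.swap_apply_of_ne_of_ne e1 e2]
    have e1' : (k : ℕ) ≠ pre.length := fun h => e1 (Fin.ext h)
    have e2' : (k : ℕ) ≠ pre.length + 1 := fun h => e2 (Fin.ext h)
    simp only [hL, List.getD_eq_getElem?_getD]
    rcases lt_or_ge (k : ℕ) pre.length with h | h
    · rw [List.getElem?_append_left h, List.getElem?_append_left h]
    · rw [List.getElem?_append_right h, List.getElem?_append_right h]
      obtain ⟨t, ht⟩ : ∃ t, (k : ℕ) - pre.length = t + 2 := ⟨k - pre.length - 2, by omega⟩
      rw [ht]; simp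
  rw [this, Matrix.det_permute', Equiv.Perm.sign_swap (by simp [Fin.ext_iff])]
  simp [minor]

theorem minor_perm {l l' : List ℕ} (h : l.Perm l') :
    ∃ ε : ℤˣ, ∀ pre, minor f (pre ++ l') = (ε : ℤ) * minor f (pre ++ l) := by
  induction h with
  | nil => exact ⟨1, by simp⟩
  | cons x _ ih =>
    obtain ⟨ε, h⟩ := ih
    exact ⟨ε, fun pre => by simpa using h (pre ++ [x])⟩
  | swap x y l => exact ⟨-1, fun pre => by rw [minor_swap]; simp⟩
  | trans _ _ ih1 ih2 =>
    obtain ⟨ε, h⟩ := ih1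
    obtain ⟨ε', h'⟩ := ih2
    exact ⟨ε' * ε, fun pre => by rw [h', h]; push_cast; ring⟩

/-- The list `[r - 1, …, 1, 0]`. -/
def downList (r : ℕ) : List ℕ := (List.range r).reverse

theorem downList_succ (r : ℕ) : downList (r + 1) = r :: downList r := by
  simp [downList, List.range_succ]

theorem length_downList (r : ℕ) : (downList r).length = r := by simp [downList]

theorem mem_downList {r i : ℕ} : i ∈ downList r ↔ i < r := by simp [downList]

theorem minor_cons_downList (hf : ∀ i k, k < i → f i k = 0) (r j : ℕ) :
    minor f (j :: downList r) = f r j * minor f (downList r) := by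
  rw [minor_cons, Matrix.det_succ_row_zero, Fin.sum_univ_succ, Finset.sum_eq_zero]
  · simp [length_downList, minor]
    congr 2
    ext i k
    simp [Nat.sub_sub, add_comm]
  · intro i _
    have : (downList r).getD i 0 < r := by
      have hi : (i : ℕ) < (downList r).length := i.2
      rw [List.getD_eq_getElem _ _ hi, ← mem_downList]
      exact List.getElem_mem hi
    simp only [Matrix.of_apply, Matrix.cons_val_succ]
    rw [hf _ _ (by simpa [length_downList] using this)]
    ring

theorem minor_downList (hf : ∀ i k, k < i → f i k = 0) (r : ℕ) :
    minor f (downList r) = ∏ i ∈ Finset.range r, f i i := by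
  induction r with
  | zero => simp [downList, minor_nil]
  | succ r ih =>
    rw [downList_succ, minor_cons_downList f hf, ih, Finset.prod_range_succ, mul_comm]

theorem minor_eq_zero_of_row_eq {l : List ℕ} {i : ℕ} (hi : i + 1 < l.length) {t : R}
    (h : ∀ k, f i k = t * f (i + 1) k) : minor f l = 0 := by
  unfold minor
  have := Matrix.det_updateRow_add_smul_self
    (Matrix.of fun i k : Fin l.length => f (l.length - 1 - i) (l.getD k 0))
    (i := ⟨l.length - 1 - i, by omega⟩) (j := ⟨l.length - 1 - (i + 1), by omega⟩)
    (by simp [Fin.ext_iff]; omega) (-t)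
  rw [← this]
  refine Matrix.det_eq_zero_of_row_eq_zero ⟨l.length - 1 - i, by omega⟩ fun k => ?_
  have e1 : l.length - 1 - (l.length - 1 - i) = i := by omega
  have e2 : l.length - 1 - (l.length - 1 - (i + 1)) = i + 1 := by omega
  simp only [Matrix.updateRow_self, Pi.add_apply, Pi.smul_apply, Matrix.of_apply, smul_eq_mul, e1, e2, h]
  ring

theorem map_minor {S : Type*} [CommRing S] (φ : R →+* S) (l : List ℕ) :
    φ (minor f l) = minor (fun i k => φ (f i k)) l := by
  unfold minor
  rw [RingHom.map_det]
  rfl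

end Minor

theorem natDegree_minor_le (f : ℕ → ℕ → ℝ[X]) (l : List ℕ) (u : ℕ → ℕ)
    (h : ∀ i < l.length, ∀ k ∈ l, (f i k).natDegree + 1 ≤ u i + if k < l.length then 1 else 0) :
    (minor f l).natDegree + l.length ≤
      ∑ i ∈ Finset.range l.length, u i + l.countP (· < l.length) := by
  have hcount : l.countP (· < l.length) = ∑ k : Fin l.length, if l.getD k 0 < l.length then 1 else 0 := by
    rw [List.countP_eq_length_filter]
    have : ∀ (L : List ℕ) (r : ℕ), (L.filter (· < r)).length =
        ∑ k : Fin L.length, if L.getD k 0 < r then 1 else 0 := by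
      intro L r
      induction L with
      | nil => simp
      | cons a L ih =>
        have : ∑ k : Fin (a :: L).length, (if (a :: L).getD k 0 < r then 1 else 0) =
            (if a < r then 1 else 0) + ∑ k : Fin L.length, if L.getD k 0 < r then 1 else 0 :=
          Fin.sum_univ_succ (n := L.length) (fun k => if (a :: L).getD k 0 < r then 1 else 0)
        rw [this, ← ih, List.filter_cons]
        split_ifs <;> simp_all; omega
    exact this l _
  have hrow : ∑ i : Fin l.length, u (l.length - 1 - i) = ∑ i ∈ Finset.range l.length, u i := by
    rw [← Finset.sum_range_reflect, Finset.sum_range]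
  have key : ∀ τ : Equiv.Perm (Fin l.length),
      ∑ i : Fin l.length, (f (l.length - 1 - (τ i : Fin l.length)) (l.getD i 0)).natDegree + l.length ≤
        ∑ i ∈ Finset.range l.length, u i + l.countP (· < l.length) := by
    intro τ
    rw [hcount, ← hrow, ← Equiv.sum_comp τ (fun i : Fin l.length => u (l.length - 1 - i)),
      ← Finset.sum_add_distrib]
    calc _ = ∑ i : Fin l.length, ((f (l.length - 1 - (τ i : Fin l.length)) (l.getD i 0)).natDegree + 1) := by
          simp [Finset.sum_add_distrib]
      _ ≤ _ := Finset.sum_le_sum fun i _ => h _ (by have := i.2; omega) _ (by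
          rw [List.getD_eq_getElem _ _ i.2]; exact List.getElem_mem _)
  have hb := key 1
  suffices (minor f l).natDegree ≤
      ∑ i ∈ Finset.range l.length, u i + l.countP (· < l.length) - l.length by omega
  unfold minor
  rw [Matrix.det_apply]
  refine natDegree_sum_le_of_forall_le _ _ fun τ _ => ?_
  refine (natDegree_smul_le _ _).trans ((natDegree_prod_le _ _).trans ?_)
  have := key τ
  simp only [Matrix.of_apply]
  omega

theorem SameSign.mul {s : Set ℝ} {g h : ℝ → ℝ} (hg : SameSign s g) (hh : SameSign s h) :
    SameSign s fun x => g x * h x := by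
  obtain ⟨e, he⟩ := hg
  obtain ⟨e', he'⟩ := hh
  exact ⟨e * e', fun x hx => by have := mul_pos (he x hx) (he' x hx); linarith⟩

theorem SameSign.inv {s : Set ℝ} {g : ℝ → ℝ} (hg : SameSign s g) : SameSign s fun x => (g x)⁻¹ := by
  obtain ⟨e, he⟩ := hg
  refine ⟨e⁻¹, fun x hx => ?_⟩
  rw [← mul_inv]
  exact inv_pos.2 (he x hx)

theorem SameSign.div {s : Set ℝ} {g h : ℝ → ℝ} (hg : SameSign s g) (hh : SameSign s h) :
    SameSign s fun x => g x / h x := by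
  simpa only [div_eq_mul_inv] using hg.mul hh.inv

theorem SameSign.neg {s : Set ℝ} {g : ℝ → ℝ} (hg : SameSign s g) : SameSign s fun x => - g x := by
  obtain ⟨e, he⟩ := hg
  exact ⟨-e, fun x hx => by simpa using he x hx⟩

theorem SameSign.mono {s t : Set ℝ} {g : ℝ → ℝ} (hg : SameSign s g) (h : t ⊆ s) : SameSign t g := by
  obtain ⟨e, he⟩ := hg
  exact ⟨e, fun x hx => he x (h hx)⟩

theorem SameSign.congr {s : Set ℝ} {g h : ℝ → ℝ} (hg : SameSign s g) (e : ∀ x ∈ s, g x = h x) :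
    SameSign s h := by
  obtain ⟨c, hc⟩ := hg
  exact ⟨c, fun x hx => e x hx ▸ hc x hx⟩

theorem SameSign.ne_zero {s : Set ℝ} {g : ℝ → ℝ} (hg : SameSign s g) {x : ℝ} (hx : x ∈ s) : g x ≠ 0 := by
  obtain ⟨e, he⟩ := hg
  intro h
  have := he x hx
  simp [h] at this

theorem SameSign.pos {s : Set ℝ} {g : ℝ → ℝ} (h : ∀ x ∈ s, 0 < g x) : SameSign s g :=
  ⟨1, fun x hx => by simpa using h x hx⟩

theorem sameSign_of_continuousOn {I : Set ℝ} (hI : I.OrdConnected) {f : ℝ → ℝ} (hf : ContinuousOn f I)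
    (h0 : ∀ x ∈ I, f x ≠ 0) : SameSign I f := by
  rcases I.eq_empty_or_nonempty with rfl | ⟨x₀, hx₀⟩
  · exact ⟨1, by simp⟩
  refine ⟨f x₀, fun x hx => ?_⟩
  by_contra hneg
  have hneg : f x₀ * f x < 0 :=
    lt_of_le_of_ne (not_lt.1 hneg) (mul_ne_zero (h0 _ hx₀) (h0 _ hx))
  have : (0 : ℝ) ∈ f '' I := by
    have hp := hI.isPreconnected
    rcases mul_neg_iff.1 hneg with ⟨h1, h2⟩ | ⟨h1, h2⟩
    · exact hp.intermediate_value hx hx₀ hf ⟨h2.le, h1.le⟩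
    · exact hp.intermediate_value hx₀ hx hf ⟨h1.le, h2.le⟩
  obtain ⟨y, hy, hy0⟩ := this
  exact h0 y hy hy0

theorem eval_nodal_ne_zero {Z : Finset ℝ} {x : ℝ} (h : x ∉ Z) : (Lagrange.nodal Z id).eval x ≠ 0 := by
  rw [Lagrange.eval_nodal]
  exact Finset.prod_ne_zero_iff.2 fun a ha => sub_ne_zero.2 fun e => h (by simpa [e] using ha)

theorem eval_nodal_eq_zero {Z : Finset ℝ} {x : ℝ} (h : x ∈ Z) : (Lagrange.nodal Z id).eval x = 0 :=
  Lagrange.eval_nodal_at_node (v := id) h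

theorem eval_derivative_nodal_ne_zero {Z : Finset ℝ} {x : ℝ} (h : x ∈ Z) :
    (derivative (Lagrange.nodal Z id)).eval x ≠ 0 := by
  have := Lagrange.eval_nodal_derivative_eval_node_eq (v := id) h
  simp only [id] at this
  rw [this]
  exact eval_nodal_ne_zero (by simp)

theorem sameSign_nodal {I : Set ℝ} (hI : I.OrdConnected) {Z : Finset ℝ} {c : ℝ} (hc : c ≠ 0)
    (hZ : Disjoint (Z : Set ℝ) I) : SameSign I fun x => (C c * Lagrange.nodal Z id).eval x := by
  refine sameSign_of_continuousOn hI (Polynomial.continuous _).continuousOn fun x hx => ?_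
  rw [eval_mul, eval_C]
  exact mul_ne_zero hc (eval_nodal_ne_zero fun h => Set.disjoint_left.1 hZ (by exact_mod_cast h) hx)

theorem coeff_eq_sum_div_derivative (Z : Finset ℝ) {B : ℝ[X]} (hB : B.degree < Z.card) :
    B.coeff (Z.card - 1) = ∑ ζ ∈ Z, B.eval ζ / (derivative (Lagrange.nodal Z id)).eval ζ := by
  rw [Lagrange.coeff_eq_sum (s := Z) (v := id) (fun _ _ _ _ h => h) hB]
  refine Finset.sum_congr rfl fun ζ hζ => ?_
  have := Lagrange.eval_nodal_derivative_eval_node_eq (v := id) hζ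
  simp only [id] at this ⊢
  rw [this, Lagrange.eval_nodal]
  simp

theorem sum_div_derivative_eq_zero (Z : Finset ℝ) {B : ℝ[X]} (hB : B = 0 ∨ B.natDegree + 1 < Z.card) :
    ∑ ζ ∈ Z, B.eval ζ / (derivative (Lagrange.nodal Z id)).eval ζ = 0 := by
  rcases hB with rfl | hB
  · simp
  rw [← coeff_eq_sum_div_derivative Z (lt_of_le_of_lt degree_le_natDegree (by exact_mod_cast (by omega)))]
  exact coeff_eq_zero_of_natDegree_lt (by omega)

theorem eq_sum_nodal_erase (Z : Finset ℝ) {B : ℝ[X]} (hB : B.degree < Z.card) :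
    B = ∑ ζ ∈ Z, C (B.eval ζ / (derivative (Lagrange.nodal Z id)).eval ζ) *
      Lagrange.nodal (Z.erase ζ) id := by
  refine eq_of_degrees_lt_of_eval_finset_eq Z hB ?_ ?_
  · rw [← mem_degreeLT]
    refine Submodule.sum_mem _ fun ζ hζ => ?_
    rw [mem_degreeLT]
    refine lt_of_le_of_lt ((smul_eq_C_mul (p := Lagrange.nodal (Z.erase ζ) id) _).symm ▸ degree_smul_le _ _) ?_
    rw [Lagrange.degree_nodal]
    exact_mod_cast Finset.card_erase_lt_of_mem hζ
  · intro ζ hζ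
    have := Lagrange.eval_nodal_derivative_eval_node_eq (v := id) hζ
    simp only [id] at this
    rw [eval_finsetSum, Finset.sum_eq_single ζ]
    · rw [eval_mul, eval_C, ← this, div_mul_cancel₀ _ (eval_derivative_nodal_ne_zero hζ)]
    · intro ζ' _ hne
      rw [eval_mul, eval_nodal_eq_zero (Finset.mem_erase.2 ⟨hne.symm, hζ⟩), mul_zero]
    · intro h; exact absurd hζ h

theorem partial_fraction {K : Type*} [Field K] [Algebra ℝ K] (Z : Finset ℝ) {B : ℝ[X]}
    (hB : B.degree < Z.card) {z : K} (hz : ∀ ζ ∈ Z, z - algebraMap ℝ K ζ ≠ 0) :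
    aeval z B = aeval z (Lagrange.nodal Z id) * ∑ ζ ∈ Z,
      algebraMap ℝ K (B.eval ζ / (derivative (Lagrange.nodal Z id)).eval ζ) / (z - algebraMap ℝ K ζ) := by
  conv_lhs => rw [eq_sum_nodal_erase Z hB]
  rw [map_sum, Finset.mul_sum]
  refine Finset.sum_congr rfl fun ζ hζ => ?_
  rw [Lagrange.nodal_eq_mul_nodal_erase hζ]
  simp only [map_mul, aeval_C, map_sub, aeval_X, id]
  have := hz ζ hζ
  field_simp

theorem interlacing {I : Set ℝ} (hI : I.OrdConnected) {Z : Finset ℝ} (hZI : (Z : Set ℝ) ⊆ I)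
    {B : ℝ[X]} (hZ : Z.Nonempty) (hB : B.natDegree < Z.card)
    (hs : SameSign Z fun ζ => B.eval ζ / (derivative (Lagrange.nodal Z id)).eval ζ) :
    ∃ (Y : Finset ℝ) (c : ℝ), c ≠ 0 ∧ (Y : Set ℝ) ⊆ I ∧ B = C c * Lagrange.nodal Y id ∧
      Y.card + 1 = Z.card ∧ (∀ η ∈ Y, η ∉ Z) ∧
      SameSign Y fun η => (Lagrange.nodal Z id).eval η * (derivative B).eval η := by
  have hB' : B.degree < Z.card := lt_of_le_of_lt degree_le_natDegree (by exact_mod_cast hB)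
  set ρ : ℝ → ℝ := fun ζ => B.eval ζ / (derivative (Lagrange.nodal Z id)).eval ζ with hρ
  obtain ⟨e, he⟩ := hs
  have he : ∀ ζ ∈ Z, 0 < e * ρ ζ := fun ζ hζ => he ζ (by exact_mod_cast hζ)
  have hBZ : ∀ ζ ∈ Z, B.eval ζ ≠ 0 := by
    intro ζ hζ h
    have := he ζ hζ
    simp [hρ, h] at this
  have hcoef : 0 < e * B.coeff (Z.card - 1) := by
    rw [coeff_eq_sum_div_derivative Z hB', Finset.mul_sum]
    exact Finset.sum_pos he hZ
  have hB0 : B ≠ 0 := by rintro rfl; simp at hcoef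
  have hdeg : B.natDegree + 1 = Z.card := by
    have h1 : B.coeff (Z.card - 1) ≠ 0 := by intro h; simp [h] at hcoef
    have := le_natDegree_of_ne_zero h1
    have := hZ.card_pos
    omega
  -- All complex roots are real.
  have hreal : ∀ z : ℂ, aeval z B = 0 → z.im = 0 := by
    intro z hz
    by_contra him
    have hne : ∀ ζ ∈ Z, z - algebraMap ℝ ℂ ζ ≠ 0 := by
      intro ζ _ h
      apply him
      have := congrArg Complex.im h
      simpa using this
    rw [partial_fraction Z hB' hne] at hz
    have hnod : aeval z (Lagrange.nodal Z id) ≠ 0 := by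
      rw [Lagrange.nodal, map_prod]
      refine Finset.prod_ne_zero_iff.2 fun ζ hζ => ?_
      simpa using hne ζ hζ
    have hz := (mul_eq_zero.1 hz).resolve_left hnod
    have him2 := congrArg Complex.im hz
    rw [Complex.im_sum] at him2
    have hterm : ∀ ζ ∈ Z, (algebraMap ℝ ℂ (ρ ζ) / (z - algebraMap ℝ ℂ ζ)).im =
        - z.im * (ρ ζ / Complex.normSq (z - ζ)) := by
      intro ζ _
      simp [Complex.div_im]
      ring
    rw [Finset.sum_congr rfl hterm, ← Finset.mul_sum] at him2
    have hpos : 0 < e * ∑ ζ ∈ Z, ρ ζ / Complex.normSq (z - ζ) := by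
      rw [Finset.mul_sum]
      refine Finset.sum_pos (fun ζ hζ => ?_) hZ
      rw [← mul_div_assoc]
      exact div_pos (he ζ hζ) (Complex.normSq_pos.2 (hne ζ hζ))
    simp only [Complex.zero_im, mul_eq_zero, neg_eq_zero, him, false_or] at him2
    rw [him2] at hpos
    simp at hpos
  have hsplit : B.Splits := by
    refine Splits.of_splits_map (algebraMap ℝ ℂ) (IsAlgClosed.splits _) fun z hz => ?_
    have hz' : aeval z B = 0 := by
      have := (mem_roots'.1 hz).2
      rwa [IsRoot, eval_map_algebraMap] at this
    exact ⟨z.re, Complex.ext (by simp) (by simp [hreal z hz'])⟩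
  have hpf : ∀ x : ℝ, x ∉ Z → B.eval x = (Lagrange.nodal Z id).eval x * ∑ ζ ∈ Z, ρ ζ / (x - ζ) := by
    intro x hx
    have := partial_fraction (K := ℝ) Z hB' (z := x)
      (fun ζ hζ => sub_ne_zero.2 fun h => hx (by rw [h]; simpa using hζ))
    simpa [coe_aeval_eq_eval] using this
  have hrootZ : ∀ η, B.eval η = 0 → η ∉ Z := fun η h hZ' => hBZ η hZ' h
  have hsum : ∀ η, B.eval η = 0 → ∑ ζ ∈ Z, ρ ζ / (η - ζ) = 0 := by
    intro η h
    have h2 := hpf η (hrootZ η h)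
    rw [h] at h2
    exact (mul_eq_zero.1 h2.symm).resolve_left (eval_nodal_ne_zero (hrootZ η h))
  have hder : ∀ η, B.eval η = 0 → (derivative B).eval η =
      (Lagrange.nodal Z id).eval η * ∑ ζ ∈ Z, - ρ ζ / (η - ζ) ^ 2 := by
    intro η h
    have h1 : HasDerivAt (fun x => (Lagrange.nodal Z id).eval x * ∑ ζ ∈ Z, ρ ζ / (x - ζ))
        ((derivative (Lagrange.nodal Z id)).eval η * (∑ ζ ∈ Z, ρ ζ / (η - ζ)) +
          (Lagrange.nodal Z id).eval η * ∑ ζ ∈ Z, - ρ ζ / (η - ζ) ^ 2) η := by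
      refine (Polynomial.hasDerivAt _ _).mul (HasDerivAt.fun_sum fun ζ hζ => ?_)
      have hne : η - ζ ≠ 0 := sub_ne_zero.2 fun h' => hrootZ η h (h' ▸ hζ)
      have := (hasDerivAt_const η (ρ ζ)).div ((hasDerivAt_id η).sub_const ζ) hne
      exact HasDerivAt.congr_deriv (f := fun x => ρ ζ / (x - ζ)) this (by simp)
    rw [hsum η h, mul_zero, zero_add] at h1
    have hev : (fun x => (Lagrange.nodal Z id).eval x * ∑ ζ ∈ Z, ρ ζ / (x - ζ)) =ᶠ[nhds η]
        fun x => B.eval x := by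
      have : (↑Z : Set ℝ)ᶜ ∈ nhds η :=
        Z.finite_toSet.isClosed.isOpen_compl.mem_nhds (by simpa using hrootZ η h)
      filter_upwards [this] with x hx
      exact (hpf x (by simpa using hx)).symm
    exact ((Polynomial.hasDerivAt B η).unique (h1.congr_of_eventuallyEq hev.symm))
  have hsgn : ∀ η, B.eval η = 0 → 0 < -e * ((Lagrange.nodal Z id).eval η * (derivative B).eval η) := by
    intro η h
    rw [hder η h]
    have : 0 < ∑ ζ ∈ Z, e * ρ ζ / (η - ζ) ^ 2 := by
      refine Finset.sum_pos (fun ζ hζ => div_pos (he ζ hζ) ?_) hZ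
      have hne : η - ζ ≠ 0 := sub_ne_zero.2 fun h' => hrootZ η h (h' ▸ hζ)
      positivity
    have h2 : ∑ ζ ∈ Z, - ρ ζ / (η - ζ) ^ 2 = - ∑ ζ ∈ Z, ρ ζ / (η - ζ) ^ 2 := by
      rw [← Finset.sum_neg_distrib]
      exact Finset.sum_congr rfl fun _ _ => by ring
    have h3 : ∑ ζ ∈ Z, e * ρ ζ / (η - ζ) ^ 2 = e * ∑ ζ ∈ Z, ρ ζ / (η - ζ) ^ 2 := by
      rw [Finset.mul_sum]
      exact Finset.sum_congr rfl fun _ _ => by ring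
    rw [h3] at this
    rw [h2]
    have hn := eval_nodal_ne_zero (hrootZ η h)
    have := mul_pos this (pow_pos (abs_pos.2 hn) 2)
    rw [sq_abs] at this
    nlinarith
  have hnodup : B.roots.Nodup := by
    rw [Multiset.nodup_iff_count_le_one]
    intro a
    rw [count_roots]
    by_contra! hlt
    have h1 := (one_lt_rootMultiplicity_iff_isRoot hB0).1 hlt
    have := hsgn a h1.1
    rw [h1.2] at this
    simp at this
  refine ⟨B.roots.toFinset, B.leadingCoeff, leadingCoeff_ne_zero.2 hB0, ?_, ?_, ?_, ?_, ?_⟩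
  · intro η hη
    have hη0 : B.eval η = 0 := by
      simp only [Finset.mem_coe, Multiset.mem_toFinset] at hη
      exact (mem_roots'.1 hη).2
    have hs0 := hsum η hη0
    by_contra hnot
    -- `η` lies on one side of all of `Z`.
    have hside : (∀ ζ ∈ Z, η < ζ) ∨ ∀ ζ ∈ Z, ζ < η := by
      by_contra! hcon
      obtain ⟨⟨a, ha, ha'⟩, b, hb, hb'⟩ := hcon
      exact hnot (hI.out (hZI ha) (hZI hb) ⟨ha', hb'⟩)
    rcases hside with hside | hside
    · have : 0 < ∑ ζ ∈ Z, -(e * (ρ ζ / (η - ζ))) := by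
        refine Finset.sum_pos (fun ζ hζ => ?_) hZ
        rw [← mul_div_assoc, ← div_neg]
        exact div_pos (he ζ hζ) (by linarith [hside ζ hζ])
      rw [Finset.sum_neg_distrib, ← Finset.mul_sum, hs0] at this
      simp at this
    · have : 0 < ∑ ζ ∈ Z, (e * (ρ ζ / (η - ζ))) := by
        refine Finset.sum_pos (fun ζ hζ => ?_) hZ
        rw [← mul_div_assoc]
        exact div_pos (he ζ hζ) (by linarith [hside ζ hζ])
      rw [← Finset.mul_sum, hs0] at this
      simp at this
  · conv_lhs => rw [hsplit.eq_prod_roots]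
    rw [Lagrange.nodal, Finset.prod_eq_multiset_prod, Multiset.toFinset_val, hnodup.dedup]
    rfl
  · rw [Multiset.toFinset_card_of_nodup hnodup, ← hsplit.natDegree_eq_card_roots, hdeg]
  · intro η hη
    exact hrootZ η (mem_roots'.1 (Multiset.mem_toFinset.1 hη)).2
  · exact ⟨-e, fun η hη => hsgn η (mem_roots'.1 (Multiset.mem_toFinset.1 (by exact_mod_cast hη))).2⟩

theorem weak_sign_of_interior {I : Set ℝ} (hI : I.OrdConnected) {f : ℝ → ℝ} (hf : ContinuousOn f I)
    (h0 : ∀ x ∈ interior I, f x ≠ 0) : ∃ e : ℝ, e ≠ 0 ∧ ∀ x ∈ I, 0 ≤ e * f x := by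
  rcases (interior I).eq_empty_or_nonempty with hE | hne
  · have hsub : I.Subsingleton := by
      intro a ha b hb
      by_contra hab
      wlog hlt : a < b generalizing a b
      · exact this hb ha (Ne.symm hab) (lt_of_le_of_ne (not_lt.1 hlt) (Ne.symm hab))
      have : Ioo a b ⊆ interior I := by
        rw [isOpen_Ioo.subset_interior_iff]
        exact Ioo_subset_Icc_self.trans (hI.out ha hb)
      rw [hE] at this
      obtain ⟨c, hc⟩ := exists_between hlt
      exact this hc
    rcases I.eq_empty_or_nonempty with rfl | ⟨x₀, hx₀⟩
    · exact ⟨1, one_ne_zero, by simp⟩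
    · rcases le_total 0 (f x₀) with h | h
      · exact ⟨1, one_ne_zero, fun x hx => by rw [hsub hx hx₀]; simpa using h⟩
      · exact ⟨-1, by norm_num, fun x hx => by rw [hsub hx hx₀]; simpa using h⟩
  · obtain ⟨e, he⟩ := sameSign_of_continuousOn hI.interior (hf.mono interior_subset) h0
    obtain ⟨y, hy⟩ := hne
    refine ⟨e, fun h => by have := he y hy; simp [h] at this, fun x hx => ?_⟩
    have hx' : x ∈ closure (interior I) := by
      rw [(hI.convex (𝕜 := ℝ)).closure_interior_eq_closure_of_nonempty_interior ⟨y, hy⟩]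
      exact subset_closure hx
    have := mem_closure_iff_nhdsWithin_neBot.1 hx'
    have ht : Tendsto (fun y => e * f y) (nhdsWithin x (interior I)) (nhds (e * f x)) :=
      (((hf x hx).mono interior_subset).const_mul e)
    exact ge_of_tendsto ht (eventually_nhdsWithin_of_forall fun y hy => (he y hy).le)

/-- A continuous function with finitely many zeros acquires a constant sign after multiplication by the
monic polynomial with simple zeros at the points where it changes sign. -/
theorem exists_sign_changes {I : Set ℝ} (hI : I.OrdConnected) {f : ℝ → ℝ} (hf : ContinuousOn f I)
    (hfin : {x ∈ interior I | f x = 0}.Finite) :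
    ∃ R : Finset ℝ, (R : Set ℝ) ⊆ {x ∈ interior I | f x = 0} ∧
      ∃ e : ℝ, e ≠ 0 ∧ ∀ x ∈ I, 0 ≤ e * (f x * (Lagrange.nodal R id).eval x) := by
  induction hn : hfin.toFinset.card using Nat.strong_induction_on generalizing I with
  | _ n ih =>
  by_cases hz : ∃ y ∈ interior I, f y = 0
  swap
  · push Not at hz
    obtain ⟨e, he, h⟩ := weak_sign_of_interior hI hf hz
    exact ⟨∅, by simp, e, he, by simpa using h⟩
  obtain ⟨y, hy, hy0⟩ := hz
  have step : ∀ J : Set ℝ, J.OrdConnected → y ∉ interior (I ∩ J) →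
      ∃ R : Finset ℝ, (R : Set ℝ) ⊆ {x ∈ interior (I ∩ J) | f x = 0} ∧
        ∃ e : ℝ, e ≠ 0 ∧ ∀ x ∈ I ∩ J, 0 ≤ e * (f x * (Lagrange.nodal R id).eval x) := by
    intro J hJ hyJ
    have hsub : {x ∈ interior (I ∩ J) | f x = 0} ⊆ {x ∈ interior I | f x = 0} :=
      fun x hx => ⟨interior_mono inter_subset_left hx.1, hx.2⟩
    refine ih _ ?_ (hI.inter hJ) (hf.mono inter_subset_left) (hfin.subset hsub) rfl
    rw [← hn]
    refine Finset.card_lt_card ⟨?_, fun hcon => ?_⟩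
    · intro x hx
      simp only [Finite.mem_toFinset] at hx ⊢
      exact hsub hx
    · have : y ∈ hfin.toFinset := by simpa using ⟨hy, hy0⟩
      have := hcon this
      simp only [Finite.mem_toFinset] at this
      exact hyJ this.1
  obtain ⟨R₁, hR₁, e₁, he₁, h₁⟩ := step (Iic y) ordConnected_Iic (by rw [interior_inter, interior_Iic]; simp)
  obtain ⟨R₂, hR₂, e₂, he₂, h₂⟩ := step (Ici y) ordConnected_Ici (by rw [interior_inter, interior_Ici]; simp)
  have hR₁y : ∀ a ∈ R₁, a < y := fun a ha => by
    have := (hR₁ ha).1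
    rw [interior_inter, interior_Iic] at this
    exact this.2
  have hR₂y : ∀ a ∈ R₂, y < a := fun a ha => by
    have := (hR₂ ha).1
    rw [interior_inter, interior_Ici] at this
    exact this.2
  have hd : Disjoint R₁ R₂ := by
    rw [Finset.disjoint_left]
    intro a h1 h2
    exact lt_asymm (hR₁y a h1) (hR₂y a h2)
  -- normalised signs of the other factor
  have n₁ : ∀ x, y ≤ x → 0 ≤ (Lagrange.nodal R₁ id).eval x := by
    intro x hx
    rw [Lagrange.eval_nodal]
    exact Finset.prod_nonneg fun a ha => by have := hR₁y a ha; simp only [id]; linarith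
  have n₂ : ∀ x, x ≤ y → 0 ≤ (-1) ^ R₂.card * (Lagrange.nodal R₂ id).eval x := by
    intro x hx
    rw [Lagrange.eval_nodal, ← Finset.prod_const, ← Finset.prod_mul_distrib]
    exact Finset.prod_nonneg fun a ha => by have := hR₂y a ha; simp only [id]; linarith
  have hU : ∀ x, (Lagrange.nodal (R₁ ∪ R₂) id).eval x =
      (Lagrange.nodal R₁ id).eval x * (Lagrange.nodal R₂ id).eval x := by
    intro x
    simp only [Lagrange.eval_nodal]
    exact Finset.prod_union hd
  set c₁ := e₁ * (-1) ^ R₂.card with hc₁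
  have hc₁0 : c₁ ≠ 0 := mul_ne_zero he₁ (pow_ne_zero _ (by norm_num))
  have k₁ : ∀ x ∈ I, x ≤ y → 0 ≤ c₁ * (f x * (Lagrange.nodal (R₁ ∪ R₂) id).eval x) := by
    intro x hx hxy
    rw [hU, hc₁]
    have := mul_nonneg (h₁ x ⟨hx, hxy⟩) (n₂ x hxy)
    linarith
  have k₂ : ∀ x ∈ I, y ≤ x → 0 ≤ e₂ * (f x * (Lagrange.nodal (R₁ ∪ R₂) id).eval x) := by
    intro x hx hxy
    rw [hU]
    have := mul_nonneg (h₂ x ⟨hx, hxy⟩) (n₁ x hxy)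
    linarith
  have hsubR : ((R₁ ∪ R₂ : Finset ℝ) : Set ℝ) ⊆ {x ∈ interior I | f x = 0} := by
    intro x hx
    rw [Finset.coe_union] at hx
    rcases hx with hx | hx
    · exact ⟨interior_mono inter_subset_left (hR₁ hx).1, (hR₁ hx).2⟩
    · exact ⟨interior_mono inter_subset_left (hR₂ hx).1, (hR₂ hx).2⟩
  rcases lt_or_gt_of_ne (mul_ne_zero hc₁0 he₂) with hlt | hgt
  · have hynot : y ∉ R₁ ∪ R₂ := by
      rw [Finset.mem_union]
      rintro (h | h)
      · exact lt_irrefl _ (hR₁y y h)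
      · exact lt_irrefl _ (hR₂y y h)
    refine ⟨insert y (R₁ ∪ R₂), ?_, e₂, he₂, fun x hx => ?_⟩
    · rw [Finset.coe_insert]
      exact insert_subset ⟨hy, hy0⟩ hsubR
    · have : (Lagrange.nodal (insert y (R₁ ∪ R₂)) id).eval x =
          (x - y) * (Lagrange.nodal (R₁ ∪ R₂) id).eval x := by
        simp only [Lagrange.eval_nodal]
        exact Finset.prod_insert hynot
      rw [this]
      rcases le_total x y with hxy | hxy
      · have h1 := k₁ x hx hxy
        set F := f x * (Lagrange.nodal (R₁ ∪ R₂) id).eval x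
        have h2 : 0 ≤ -(e₂ * F) := by
          have : 0 ≤ (c₁ * F) * (-(c₁ * e₂)) := mul_nonneg h1 (by linarith)
          have h3 : (c₁ * F) * (-(c₁ * e₂)) = c₁ ^ 2 * (-(e₂ * F)) := by ring
          rw [h3] at this
          exact nonneg_of_mul_nonneg_right this (by positivity)
        have := mul_nonneg h2 (sub_nonneg.2 hxy)
        linarith [show e₂ * (f x * ((x - y) * (Lagrange.nodal (R₁ ∪ R₂) id).eval x)) =
          -(e₂ * F) * (y - x) by simp only [F]; ring]
      · have h1 := k₂ x hx hxy
        have := mul_nonneg h1 (sub_nonneg.2 hxy)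
        linarith
  · refine ⟨R₁ ∪ R₂, hsubR, e₂, he₂, fun x hx => ?_⟩
    rcases le_total x y with hxy | hxy
    · have h1 := k₁ x hx hxy
      set F := f x * (Lagrange.nodal (R₁ ∪ R₂) id).eval x
      have : 0 ≤ (c₁ * F) * (c₁ * e₂) := mul_nonneg h1 hgt.le
      have h3 : (c₁ * F) * (c₁ * e₂) = c₁ ^ 2 * (e₂ * F) := by ring
      rw [h3] at this
      exact nonneg_of_mul_nonneg_right this (by positivity)
    · exact k₂ x hx hxy

theorem nodal_dvd {Z : Finset ℝ} {p : ℝ[X]} (h : ∀ a ∈ Z, p.eval a = 0) : Lagrange.nodal Z id ∣ p := by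
  refine Finset.prod_dvd_of_coprime (fun a _ b _ hab => ?_) fun a ha => dvd_iff_isRoot.2 (h a ha)
  exact isCoprime_X_sub_C_of_isUnit_sub (sub_ne_zero.2 hab).isUnit

theorem isCoprime_nodal {Z Y : Finset ℝ} (h : Disjoint Z Y) :
    IsCoprime (Lagrange.nodal Z id : ℝ[X]) (Lagrange.nodal Y id) := by
  refine IsCoprime.prod_left fun a ha => IsCoprime.prod_right fun b hb => ?_
  refine isCoprime_X_sub_C_of_isUnit_sub (sub_ne_zero.2 ?_).isUnit
  rintro rfl
  exact Finset.disjoint_left.1 h ha hb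

/-- A Nikishin system of discrete measures: the measure of level `i ≥ 1` has the atoms `Z i ⊆ I i` with
the weights `w i`, and `f i k / nodal (Z (i + 1))` is the Cauchy transform of the iterated product of the
measures of levels `i + 1, …, k`. -/
structure DiscreteNikishin (m K : ℕ) where
  I : ℕ → Set ℝ
  Z : ℕ → Finset ℝ
  w : ℕ → ℝ → ℝ
  f : ℕ → ℕ → ℝ[X]
  ordConnected : ∀ i, (I i).OrdConnected
  disjoint_I : ∀ i, Disjoint (I i) (I (i + 1))
  subset_I : ∀ i, (Z i : Set ℝ) ⊆ I i
  disjoint_Z : ∀ i j, i ≠ j → Disjoint (Z i) (Z j)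
  Z_zero : Z 0 = ∅
  Z_top : Z (m + 1) = ∅
  le_card : ∀ i, 1 ≤ i → i ≤ m → K ≤ (Z i).card
  sameSign : ∀ i, SameSign (Z i) (w i)
  f_diag : ∀ i ≤ m, f i i = Lagrange.nodal (Z (i + 1)) id
  f_lower : ∀ i k, k < i → f i k = 0
  f_degree : ∀ i ≤ m, ∀ k ≤ m, (f i k).natDegree + 1 ≤ (Z (i + 1)).card + if k ≤ i then 1 else 0
  f_eval : ∀ i k, ∀ a ∈ Z (i + 1), (f i k).eval a * (Lagrange.nodal (Z (i + 2)) id).eval a =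
    w (i + 1) a * (derivative (Lagrange.nodal (Z (i + 1)) id)).eval a * (f (i + 1) k).eval a

namespace DiscreteNikishin

variable {m K : ℕ} (D : DiscreteNikishin m K)

/-- The monic polynomial vanishing at the atoms of level `i`. -/
def A (i : ℕ) : ℝ[X] := Lagrange.nodal (D.Z i) id

/-- The trivial factor of the minors of size `r`. -/
def trivialFactor (r : ℕ) : ℝ[X] := ∏ i ∈ Finset.Ico 1 r, D.A i

theorem A_ne_zero (i : ℕ) : D.A i ≠ 0 := Lagrange.nodal_ne_zero

theorem trivialFactor_ne_zero (r : ℕ) : D.trivialFactor r ≠ 0 :=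
  Finset.prod_ne_zero_iff.2 fun i _ => D.A_ne_zero i

theorem trivialFactor_dvd (l : List ℕ) : D.trivialFactor l.length ∣ minor D.f l := by
  refine Finset.prod_dvd_of_coprime (fun i _ j _ hij => isCoprime_nodal (D.disjoint_Z i j hij))
    fun i hi => nodal_dvd fun a ha => ?_
  rw [Finset.mem_Ico] at hi
  obtain ⟨i, rfl⟩ : ∃ i', i = i' + 1 := ⟨i - 1, by omega⟩
  rw [← coe_evalRingHom, map_minor]
  have hne : (Lagrange.nodal (D.Z (i + 2)) id).eval a ≠ 0 :=
    eval_nodal_ne_zero fun h => Finset.disjoint_left.1 (D.disjoint_Z (i + 1) (i + 2) (by omega)) ha h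
  refine minor_eq_zero_of_row_eq _ (i := i) hi.2
    (t := D.w (i + 1) a * (derivative (Lagrange.nodal (D.Z (i + 1)) id)).eval a /
      (Lagrange.nodal (D.Z (i + 2)) id).eval a) fun k => ?_
  have := D.f_eval i k a ha
  simp only [coe_evalRingHom]
  field_simp
  linarith

/-- The reduced minors. -/
def N (l : List ℕ) : ℝ[X] := minor D.f l / D.trivialFactor l.length

theorem trivialFactor_mul_N (l : List ℕ) : D.trivialFactor l.length * D.N l = minor D.f l :=
  EuclideanDomain.mul_div_cancel' (D.trivialFactor_ne_zero _) (D.trivialFactor_dvd l)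

theorem N_pluecker (a b j : ℕ) (l : List ℕ) :
    D.N (b :: l) * D.N (j :: a :: l) - D.N (j :: l) * D.N (b :: a :: l) =
      D.N (a :: l) * D.N (j :: b :: l) := by
  have h := minor_pluecker D.f a b j l
  simp only [← D.trivialFactor_mul_N, List.length_cons] at h
  refine mul_left_cancel₀ (mul_ne_zero (D.trivialFactor_ne_zero (l.length + 1))
    (D.trivialFactor_ne_zero (l.length + 1 + 1))) ?_
  linear_combination h

theorem N_eq_zero_of_mem {j : ℕ} {l : List ℕ} (h : j ∈ l) : D.N (j :: l) = 0 := by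
  have := D.trivialFactor_mul_N (j :: l)
  rw [minor_eq_zero_of_mem _ h] at this
  exact (mul_eq_zero.1 this).resolve_left (D.trivialFactor_ne_zero _)

theorem N_perm {l l' : List ℕ} (h : l.Perm l') :
    ∃ ε : ℝ, ε ^ 2 = 1 ∧ ∀ pre, D.N (pre ++ l') = C ε * D.N (pre ++ l) := by
  obtain ⟨ε, hε⟩ := minor_perm D.f h
  refine ⟨((ε : ℤ) : ℝ), by rcases Int.units_eq_one_or ε with rfl | rfl <;> simp, fun pre => ?_⟩
  have h1 := hε pre
  have hlen : (pre ++ l').length = (pre ++ l).length := by simp [h.length_eq]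
  rw [← D.trivialFactor_mul_N, ← D.trivialFactor_mul_N, hlen] at h1
  refine mul_left_cancel₀ (D.trivialFactor_ne_zero (pre ++ l).length) ?_
  rw [h1]
  simp
  ring

theorem N_swap (a b : ℕ) (l : List ℕ) : D.N (a :: b :: l) = - D.N (b :: a :: l) := by
  have h1 := minor_swap D.f [] l a b
  simp only [List.nil_append, ← D.trivialFactor_mul_N, List.length_cons] at h1
  refine mul_left_cancel₀ (D.trivialFactor_ne_zero (l.length + 1 + 1)) ?_
  rw [h1]; ring

theorem natDegree_N_le (hK : m + 1 ≤ K) {l : List ℕ} (hl : l.length ≤ m + 1) (hm : ∀ k ∈ l, k ≤ m) :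
    (D.N l).natDegree + l.length ≤ (D.Z l.length).card + l.countP (· < l.length) := by
  have h := natDegree_minor_le D.f l (fun i => (D.Z (i + 1)).card) fun i hi k hk => by
    refine (D.f_degree i (by omega) k (hm k hk)).trans ?_
    gcongr
    split_ifs <;> omega
  by_cases h0 : D.N l = 0
  · rw [h0, natDegree_zero, zero_add]
    by_cases hlen : l.length = m + 1
    · rw [hlen, D.Z_top, List.countP_eq_length.2 fun k hk => by simpa using Nat.lt_succ_of_le (hm k hk)]
      omega
    · rcases Nat.eq_zero_or_pos l.length with h00 | hpos
      · omega
      · have := D.le_card l.length hpos (by omega)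
        omega
  rw [← D.trivialFactor_mul_N, natDegree_mul (D.trivialFactor_ne_zero _) h0] at h
  have ht : (D.trivialFactor l.length).natDegree = ∑ i ∈ Finset.Ico 1 l.length, (D.Z i).card := by
    rw [trivialFactor, natDegree_prod _ _ fun i _ => D.A_ne_zero i]
    exact Finset.sum_congr rfl fun i _ => Lagrange.natDegree_nodal
  rw [ht] at h
  rcases Nat.eq_zero_or_pos l.length with h00 | hpos
  · rw [h00] at h ⊢
    simpa [D.Z_zero] using h
  · have : ∑ i ∈ Finset.range l.length, (D.Z (i + 1)).card =
        ∑ i ∈ Finset.Ico 1 l.length, (D.Z i).card + (D.Z l.length).card := by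
      rw [Finset.range_eq_Ico, Finset.sum_Ico_add' (fun i => (D.Z i).card) 0 l.length 1,
        zero_add, Finset.sum_Ico_succ_top hpos]
    omega

theorem N_cons_downList (r j : ℕ) (hr : r ≤ m + 1) : D.N (j :: downList r) = D.f r j := by
  have h := minor_cons_downList D.f D.f_lower r j
  rw [minor_downList _ D.f_lower, ← D.trivialFactor_mul_N, mul_comm (D.f r j)] at h
  refine mul_left_cancel₀ (D.trivialFactor_ne_zero (j :: downList r).length) ?_
  rw [h]
  congr 1
  rw [trivialFactor, List.length_cons, length_downList, Finset.range_eq_Ico,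
    ← Finset.prod_Ico_add' (fun i => D.A i) 0 r 1]
  exact Finset.prod_congr rfl fun i hi => D.f_diag i (by rw [Finset.mem_Ico] at hi; omega)

/-- The reduced minor `N l` has only simple real zeros, all in the interval of level `l.length`, and their
number is maximal. -/
def HasRealZeros (l : List ℕ) : Prop :=
  ∃ (Y : Finset ℝ) (c : ℝ), c ≠ 0 ∧ (Y : Set ℝ) ⊆ D.I l.length ∧ D.N l = C c * Lagrange.nodal Y id ∧
    Y.card + l.length = (D.Z l.length).card + l.countP (· < l.length)

/-- The partial fraction decompositions of `N (j :: S) / N (a :: S)` have residues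
`w ζ * N (j :: a :: S) ζ` with weights `w` of constant sign. -/
def HasWeights (S : List ℕ) (a : ℕ) : Prop :=
  ∃ (Y : Finset ℝ) (c : ℝ) (w : ℝ → ℝ), c ≠ 0 ∧ (Y : Set ℝ) ⊆ D.I (S.length + 1) ∧
    D.N (a :: S) = C c * Lagrange.nodal Y id ∧
    Y.card + (S.length + 1) = (D.Z (S.length + 1)).card + (a :: S).countP (· < S.length + 1) ∧
    SameSign Y w ∧ ∀ ζ ∈ Y, ∀ j ≤ m, (D.N (j :: S)).eval ζ =
      w ζ * (derivative (D.N (a :: S))).eval ζ * (D.N (j :: a :: S)).eval ζ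

variable {D}

theorem HasWeights.hasRealZeros {S : List ℕ} {a : ℕ} (h : D.HasWeights S a) : D.HasRealZeros (a :: S) := by
  obtain ⟨Y, c, w, hc, hY, hN, hcard, -⟩ := h
  exact ⟨Y, c, hc, hY, hN, hcard⟩

theorem HasRealZeros.perm {l l' : List ℕ} (h : D.HasRealZeros l) (hp : l.Perm l') : D.HasRealZeros l' := by
  obtain ⟨Y, c, hc, hY, hN, hcard⟩ := h
  obtain ⟨ε, hε, hN'⟩ := D.N_perm hp
  have hε0 : ε ≠ 0 := by rintro rfl; simp at hε
  refine ⟨Y, ε * c, mul_ne_zero hε0 hc, by rwa [← hp.length_eq], ?_, ?_⟩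
  · have := hN' []
    simp only [List.nil_append] at this
    rw [this, hN, C_mul, mul_assoc]
  · rw [← hp.length_eq, ← hp.countP_eq]
    exact hcard

theorem sameSign_const (s : Set ℝ) {c : ℝ} (hc : c ≠ 0) : SameSign s fun _ => c :=
  ⟨c, fun _ _ => mul_self_pos.2 hc⟩

theorem HasWeights.perm {S S' : List ℕ} {a : ℕ} (h : D.HasWeights S a) (hp : S.Perm S') :
    D.HasWeights S' a := by
  obtain ⟨Y, c, w, hc, hY, hN, hcard, hw, hj⟩ := h
  obtain ⟨ε, hε, hN'⟩ := D.N_perm hp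
  have hε0 : ε ≠ 0 := by rintro rfl; simp at hε
  have h1 : ∀ b, D.N (b :: S') = C ε * D.N (b :: S) := fun b => hN' [b]
  have h2 : ∀ b c, D.N (b :: c :: S') = C ε * D.N (b :: c :: S) := fun b c => hN' [b, c]
  refine ⟨Y, ε * c, fun ζ => ε * w ζ, mul_ne_zero hε0 hc, by rwa [← hp.length_eq], ?_, ?_,
    (sameSign_const _ hε0).mul hw, ?_⟩
  · rw [h1, hN, C_mul, mul_assoc]
  · rw [← hp.length_eq, ← (hp.cons a).countP_eq]
    exact hcard
  · intro ζ hζ j hjm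
    rw [h1, h1, h2, eval_C_mul, derivative_C_mul, eval_C_mul, eval_C_mul, hj ζ hζ j hjm]
    linear_combination (-ε * w ζ * (derivative (D.N (a :: S))).eval ζ * (D.N (j :: a :: S)).eval ζ) * hε

theorem HasRealZeros.sameSign {l : List ℕ} (h : D.HasRealZeros l) {i : ℕ} (hi : l.length = i + 1) :
    SameSign (D.I i) fun x => (D.N l).eval x := by
  obtain ⟨Y, c, hc, hY, hN, -⟩ := h
  rw [hN]
  refine sameSign_nodal (D.ordConnected i) hc ?_
  rw [hi] at hY
  exact ((D.disjoint_I i).mono_right hY).symm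

theorem HasRealZeros.sameSign_succ {l : List ℕ} (h : D.HasRealZeros l) :
    SameSign (D.I (l.length + 1)) fun x => (D.N l).eval x := by
  obtain ⟨Y, c, hc, hY, hN, -⟩ := h
  rw [hN]
  exact sameSign_nodal (D.ordConnected _) hc ((D.disjoint_I _).mono_left hY)

theorem hasWeights_downList {r : ℕ} (hr : r ≤ m) : D.HasWeights (downList r) r := by
  have h1 := D.N_cons_downList r r (by omega)
  rw [D.f_diag r hr] at h1
  have hlen : (downList r).length = r := length_downList r
  have hsub : (D.Z (r + 1) : Set ℝ) ⊆ D.I (r + 1) := D.subset_I _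
  have hne : ∀ x ∈ D.I (r + 1), (Lagrange.nodal (D.Z (r + 2)) id).eval x ≠ 0 := fun x hx =>
    eval_nodal_ne_zero fun hz => Set.disjoint_left.1 (D.disjoint_I (r + 1)) hx (D.subset_I _ hz)
  refine ⟨D.Z (r + 1), 1, fun ζ => D.w (r + 1) ζ / (Lagrange.nodal (D.Z (r + 2)) id).eval ζ, one_ne_zero,
    by rwa [hlen], by rw [h1]; simp, ?_, ?_, ?_⟩
  · rw [hlen, List.countP_eq_length.2]
    · simp [hlen]
    · intro k hk
      rw [← downList_succ, mem_downList] at hk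
      simpa using hk
  · refine (D.sameSign _).div (SameSign.mono ?_ hsub)
    exact sameSign_of_continuousOn (D.ordConnected _) (Polynomial.continuous _).continuousOn hne
  · intro ζ hζ j hj
    rw [← downList_succ, D.N_cons_downList r j (by omega), downList_succ, h1, ← downList_succ,
      D.N_cons_downList (r + 1) j (by omega)]
    have := D.f_eval r j ζ hζ
    have := hne ζ (hsub hζ)
    field_simp
    linarith

theorem hasRealZeros_downList {r : ℕ} (hr : r ≤ m + 1) : D.HasRealZeros (downList r) := by
  rcases r with _ | r
  · refine ⟨∅, 1, one_ne_zero, by simp, ?_, ?_⟩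
    · have := D.trivialFactor_mul_N []
      rw [minor_nil] at this
      simpa [downList, trivialFactor] using this
    · simp [downList, D.Z_zero]
  · rw [downList_succ]
    exact (hasWeights_downList (by omega)).hasRealZeros

/-- Passing from the pivot `a` to the pivot `b`. -/
theorem HasWeights.exchange (hK : m + 1 ≤ K) {S : List ℕ} {a b : ℕ} (hS : ∀ k ∈ S, k ≤ m)
    (ha : a ≤ S.length) (hb : S.length < b) (hbm : b ≤ m) (hW : D.HasWeights S a)
    (hC : D.HasRealZeros (b :: a :: S)) : D.HasWeights S b := by
  obtain ⟨Y, c, w, hc, hY, hN, hcard, hw, hj⟩ := hW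
  have hCs := hC.sameSign (i := S.length + 1) rfl
  have hcount : (a :: S).countP (· < S.length + 1) = S.countP (· < S.length + 1) + 1 := by
    rw [List.countP_cons_of_pos]; simpa using Nat.lt_succ_of_le ha
  have hcount' : (b :: S).countP (· < S.length + 1) = S.countP (· < S.length + 1) := by
    rw [List.countP_cons_of_neg]; simpa using hb
  have hZc := D.le_card (S.length + 1) (by omega) (by omega)
  have hdeg : (D.N (b :: S)).natDegree < Y.card := by
    have := D.natDegree_N_le hK (l := b :: S) (by simp; omega) (by
      intro k hk
      rcases List.mem_cons.1 hk with rfl | hk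
      exacts [hbm, hS k hk])
    rw [List.length_cons, hcount'] at this
    omega
  have hYne : Y.Nonempty := by
    rw [← Finset.card_pos]; omega
  have hder : ∀ ζ, (derivative (D.N (a :: S))).eval ζ = c * (derivative (Lagrange.nodal Y id)).eval ζ := by
    intro ζ; rw [hN, derivative_C_mul, eval_C_mul]
  have hss : SameSign Y fun ζ => (D.N (b :: S)).eval ζ / (derivative (Lagrange.nodal Y id)).eval ζ := by
    refine ((hw.mul (sameSign_const _ hc)).mul (hCs.mono hY)).congr fun ζ hζ => ?_
    rw [hj ζ hζ b hbm, hder]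
    have := eval_derivative_nodal_ne_zero (Finset.mem_coe.1 hζ)
    field_simp
  obtain ⟨Y', c', hc', hY', hB, hcard', hdisj, hsign⟩ :=
    interlacing (D.ordConnected (S.length + 1)) hY hYne hdeg hss
  have hB'ne : ∀ η ∈ Y', (derivative (D.N (b :: S))).eval η ≠ 0 := fun η hη h => by
    have := hsign.ne_zero (Finset.mem_coe.2 hη)
    rw [h, mul_zero] at this
    exact this rfl
  refine ⟨Y', c', fun η => -((D.N (a :: S)).eval η /
    ((D.N (b :: a :: S)).eval η * (derivative (D.N (b :: S))).eval η)), hc', hY', hB, by omega, ?_, ?_⟩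
  · have hpos : SameSign Y' fun η => ((derivative (D.N (b :: S))).eval η ^ 2)⁻¹ :=
      SameSign.pos fun η hη => by have := hB'ne η hη; positivity
    refine ((((sameSign_const _ hc).mul hsign).mul (hCs.mono hY').inv).mul hpos).neg.congr fun η hη => ?_
    have h1 := hB'ne η hη
    have h2 := hCs.ne_zero (hY' hη)
    simp only [hN, eval_C_mul]
    field_simp
  · intro η hη j _
    have h1 := hB'ne η hη
    have h2 : (D.N (b :: a :: S)).eval η ≠ 0 := hCs.ne_zero (hY' hη)
    have h3 : (D.N (b :: S)).eval η = 0 := by rw [hB, eval_C_mul, eval_nodal_eq_zero hη, mul_zero]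
    have h4 := congrArg (eval η) (D.N_pluecker a b j S)
    simp only [eval_sub, eval_mul, h3, zero_mul, zero_sub] at h4
    field_simp
    linarith

/-- Interchanging the pivot with the last column. -/
theorem HasWeights.swap {S : List ℕ} {a b : ℕ} (hW : D.HasWeights (a :: S) b)
    (ha : D.HasRealZeros (a :: S)) (hb : D.HasRealZeros (b :: S)) : D.HasWeights (b :: S) a := by
  obtain ⟨Y, c, w, hc, hY, hN, hcard, hw, hj⟩ := hW
  have has := ha.sameSign_succ.mono hY
  have hbs := hb.sameSign_succ.mono hY
  refine ⟨Y, -c, fun ζ => w ζ * ((D.N (b :: S)).eval ζ / (D.N (a :: S)).eval ζ), neg_ne_zero.2 hc, hY, ?_, ?_,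
    hw.mul (hbs.div has), ?_⟩
  · rw [D.N_swap, hN, C_neg]; ring
  · rw [List.length_cons] at hcard ⊢
    rw [hcard]
    congr 1
    exact (List.Perm.swap a b S).countP_eq _
  · intro ζ hζ j hjm
    have h1 : (D.N (a :: S)).eval ζ ≠ 0 := has.ne_zero (Finset.mem_coe.2 hζ)
    have h0 : (D.N (b :: a :: S)).eval ζ = 0 := by rw [hN, eval_C_mul, eval_nodal_eq_zero hζ, mul_zero]
    have h4 := congrArg (eval ζ) (D.N_pluecker a b j S)
    have h5 := hj ζ hζ j hjm
    have hs : D.N (j :: a :: b :: S) = - D.N (j :: b :: a :: S) := by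
      have h1 := minor_swap D.f [j] S a b
      simp only [List.cons_append, List.nil_append, ← D.trivialFactor_mul_N, List.length_cons] at h1
      refine mul_left_cancel₀ (D.trivialFactor_ne_zero (S.length + 1 + 1 + 1)) ?_
      rw [h1]; ring
    rw [D.N_swap a b, hs]
    simp only [derivative_neg, eval_neg]
    simp only [eval_sub, eval_mul, h0, mul_zero, sub_zero] at h4
    rw [h5] at h4
    field_simp
    linarith

theorem perm_downList {l : List ℕ} (hl : l.Nodup) (h : ∀ k ∈ l, k < l.length) : l.Perm (downList l.length) :=
  (List.subperm_of_subset hl fun k hk => mem_downList.2 (h k hk)).perm_of_length_le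
    (by rw [length_downList])

/-- The induction parameter. -/
def rank (m : ℕ) (S : List ℕ) : ℕ := S.sum + ∑ i ∈ Finset.Ico S.length (m + 1), i

theorem rank_cons (a : ℕ) {S : List ℕ} (h : S.length ≤ m) : rank m (a :: S) + S.length = rank m S + a := by
  unfold rank
  rw [List.sum_cons, List.length_cons, Finset.sum_eq_sum_Ico_succ_bot (Nat.lt_succ_of_le h)]
  ring

theorem rank_perm {S S' : List ℕ} (h : S.Perm S') : rank m S = rank m S' := by
  unfold rank
  rw [h.sum_eq, h.length_eq]

theorem length_le_of_nodup {l : List ℕ} (hl : l.Nodup) (h : ∀ k ∈ l, k ≤ m) : l.length ≤ m + 1 := by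
  have := (List.subperm_of_subset hl fun k hk => mem_downList.2 (Nat.lt_succ_of_le (h k hk))).length_le
  rwa [length_downList] at this

/-- A list which is not a permutation of `downList` has an entry exceeding its length. -/
theorem perm_downList_or {l : List ℕ} (hl : l.Nodup) :
    l.Perm (downList l.length) ∨ ∃ b U, l.Perm (b :: U) ∧ l.length ≤ b := by
  by_cases h : ∀ k ∈ l, k < l.length
  · exact Or.inl (perm_downList hl h)
  · push Not at h
    obtain ⟨b, hb, hlt⟩ := h
    exact Or.inr ⟨b, l.erase b, List.perm_cons_erase hb, hlt⟩

theorem hasWeights_aux (hK : m + 1 ≤ K) (κ : ℕ) :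
    (∀ S b, (b :: S).Nodup → (∀ k ∈ b :: S, k ≤ m) → S.length < b → rank m (b :: S) = κ →
      D.HasWeights S b) ∧
    (∀ S x, (x :: S).Nodup → (∀ k ∈ x :: S, k ≤ m) → x ≤ S.length → rank m S = κ →
      D.HasWeights S x) := by
  induction κ using Nat.strong_induction_on with
  | _ κ ih =>
  have zeros : ∀ T : List ℕ, T.Nodup → (∀ k ∈ T, k ≤ m) →
      (∀ S b, (b :: S).Nodup → (∀ k ∈ b :: S, k ≤ m) → S.length < b → rank m (b :: S) = rank m T →
        D.HasWeights S b) → D.HasRealZeros T := by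
    intro T hT hm hA
    have hlen := length_le_of_nodup hT hm
    rcases perm_downList_or hT with hp | ⟨b, U, hp, hb⟩
    · exact (hasRealZeros_downList hlen).perm hp.symm
    · refine HasRealZeros.perm (hA U b (hp.nodup_iff.1 hT) (fun k hk => hm k (hp.mem_iff.2 hk)) ?_
        (rank_perm hp.symm)).hasRealZeros hp.symm
      have := hp.length_eq
      rw [List.length_cons] at this
      omega
  have zeros_lt : ∀ T : List ℕ, T.Nodup → (∀ k ∈ T, k ≤ m) → rank m T < κ → D.HasRealZeros T :=
    fun T hT hm hlt => zeros T hT hm fun S b h1 h2 h3 h4 => (ih _ hlt).1 S b h1 h2 h3 h4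
  have hA : ∀ S b, (b :: S).Nodup → (∀ k ∈ b :: S, k ≤ m) → S.length < b → rank m (b :: S) = κ →
      D.HasWeights S b := by
    intro S b hnd hm hb hr
    have hbm := hm b (by simp)
    have hSm : ∀ k ∈ S, k ≤ m := fun k hk => hm k (by simp [hk])
    have hndS := (List.nodup_cons.1 hnd)
    obtain ⟨a, ha, haS⟩ : ∃ a ≤ S.length, a ∉ S := by
      by_contra! hcon
      have : (downList (S.length + 1)).Subperm S :=
        List.subperm_of_subset (by simp [downList, List.nodup_range]) fun k hk =>
          hcon k (Nat.lt_succ_iff.1 (mem_downList.1 hk))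
      have := this.length_le
      rw [length_downList] at this
      omega
    have r1 := rank_cons (m := m) b (S := S) (by omega)
    have r2 := rank_cons (m := m) a (S := S) (by omega)
    have r3 := rank_cons (m := m) b (S := a :: S) (by simp; omega)
    rw [List.length_cons] at r3
    refine HasWeights.exchange hK hSm ha hb hbm
      ((ih (rank m S) (by omega)).2 S a (List.nodup_cons.2 ⟨haS, hndS.2⟩) ?_ ha rfl) (zeros_lt _ ?_ ?_ (by omega))
    · intro k hk
      rcases List.mem_cons.1 hk with rfl | hk
      exacts [by omega, hSm k hk]
    · refine List.nodup_cons.2 ⟨?_, List.nodup_cons.2 ⟨haS, hndS.2⟩⟩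
      rw [List.mem_cons, not_or]
      exact ⟨by omega, hndS.1⟩
    · intro k hk
      rcases List.mem_cons.1 hk with rfl | hk
      · exact hbm
      rcases List.mem_cons.1 hk with rfl | hk
      exacts [by omega, hSm k hk]
  refine ⟨hA, ?_⟩
  intro S x hnd hm hx hr
  have hndS := (List.nodup_cons.1 hnd)
  have hSm : ∀ k ∈ S, k ≤ m := fun k hk => hm k (by simp [hk])
  have hlen := length_le_of_nodup hnd hm
  rw [List.length_cons] at hlen
  rcases perm_downList_or hndS.2 with hp | ⟨b, U, hp, hb⟩
  · have hxl : x = S.length := by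
      by_contra hne
      exact hndS.1 (hp.mem_iff.2 (mem_downList.2 (by omega)))
    refine HasWeights.perm ?_ hp.symm
    rw [hxl]
    exact hasWeights_downList (by omega)
  · refine HasWeights.perm ?_ hp.symm
    have hnd2 : (x :: b :: U).Nodup := (hp.cons x).nodup_iff.1 hnd
    have hm2 : ∀ k ∈ x :: b :: U, k ≤ m := fun k hk => hm k ((hp.cons x).mem_iff.2 hk)
    have hnd3 : (b :: x :: U).Nodup := (List.Perm.swap b x U).nodup_iff.1 hnd2
    have hm3 : ∀ k ∈ b :: x :: U, k ≤ m := fun k hk => hm2 k ((List.Perm.swap b x U).mem_iff.2 hk)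
    have hxb : x ≠ b := by
      rintro rfl
      simp at hnd2
    have hUl := hp.length_eq
    rw [List.length_cons] at hUl
    have hrS := rank_perm (m := m) hp
    have r1 := rank_cons (m := m) b (S := U) (by omega)
    have r2 := rank_cons (m := m) x (S := U) (by omega)
    have r3 := rank_cons (m := m) b (S := x :: U) (by simp; omega)
    rw [List.length_cons] at r3
    refine HasWeights.swap ?_ (zeros_lt _ (List.nodup_cons.1 hnd3).2 (fun k hk => hm3 k (by simp [hk]))
      (by omega)) (zeros _ (List.nodup_cons.1 hnd2).2 (fun k hk => hm2 k (by simp [hk])) ?_)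
    · rcases Nat.lt_or_ge (x :: U).length b with hlt | hge
      · rcases Nat.lt_or_ge (rank m (b :: x :: U)) κ with hl | hg
        · exact (ih _ hl).1 _ _ hnd3 hm3 hlt rfl
        · exact hA _ _ hnd3 hm3 hlt (by omega)
      · rw [List.length_cons] at hge
        exact (ih (rank m (x :: U)) (by omega)).2 _ _ hnd3 hm3 (by simp; omega) rfl
    · rw [← hrS, hr]
      exact hA

theorem hasWeights (hK : m + 1 ≤ K) {S : List ℕ} {a : ℕ} (hnd : (a :: S).Nodup) (hm : ∀ k ∈ a :: S, k ≤ m) :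
    D.HasWeights S a := by
  rcases Nat.lt_or_ge S.length a with h | h
  · exact (hasWeights_aux hK _).1 S a hnd hm h rfl
  · exact (hasWeights_aux hK _).2 S a hnd hm h rfl

theorem hasRealZeros (hK : m + 1 ≤ K) {S : List ℕ} (hnd : S.Nodup) (hm : ∀ k ∈ S, k ≤ m) :
    D.HasRealZeros S := by
  cases S with
  | nil => exact hasRealZeros_downList (r := 0) (by omega)
  | cons a S => exact (hasWeights hK hnd hm).hasRealZeros

end DiscreteNikishin

/-- All the complex roots of `W` lie in `s`. -/
def RootsIn (W : ℝ[X]) (s : Set ℝ) : Prop := ∀ B : ℝ[X], (∀ x ∈ s, B.eval x ≠ 0) → IsCoprime W B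

theorem RootsIn.eval_ne_zero {W : ℝ[X]} {s : Set ℝ} (h : RootsIn W s) {x : ℝ} (hx : x ∉ s) :
    W.eval x ≠ 0 := by
  obtain ⟨a, b, hab⟩ := h (X - C x) fun y hy => by
    rw [eval_sub, eval_X, eval_C, sub_ne_zero]
    rintro rfl
    exact hx hy
  intro h0
  have := congrArg (eval x) hab
  simp [h0] at this

theorem RootsIn.mul {V W : ℝ[X]} {s : Set ℝ} (hV : RootsIn V s) (hW : RootsIn W s) : RootsIn (V * W) s :=
  fun _ hB => (hV _ hB).mul_left (hW _ hB)

theorem RootsIn.pow {V : ℝ[X]} {s : Set ℝ} (hV : RootsIn V s) (d : ℕ) : RootsIn (V ^ d) s :=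
  fun _ hB => (hV _ hB).pow_left

theorem rootsIn_X_sub_C {s : Set ℝ} {a : ℝ} (ha : a ∈ s) : RootsIn (X - C a) s := fun _ hB =>
  ((irreducible_X_sub_C a).coprime_iff_not_dvd).2 fun h => hB a ha (dvd_iff_isRoot.1 h)

theorem rootsIn_nodal {s : Set ℝ} {R : Finset ℝ} (hR : (R : Set ℝ) ⊆ s) :
    RootsIn (Lagrange.nodal R id) s :=
  fun B hB => IsCoprime.prod_left fun _ ha => rootsIn_X_sub_C (hR ha) B hB

namespace DiscreteNikishin

variable {m K : ℕ} (D : DiscreteNikishin m K)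

/-- The linear forms generated by the reduced minors. -/
def G (p : ℕ → ℝ[X]) (s : List ℕ) : ℝ[X] := ∑ j ∈ Finset.range (m + 1), p j * D.N (j :: s)

variable {D}

/-- A linear form which vanishes at as many points as there are free coefficients in
polynomials `p j`, `j ∉ s`, is trivial. -/
theorem eq_zero_of_vanishing {n : ℕ → ℕ} (hK : m + 1 + ∑ j ∈ Finset.range (m + 1), n j ≤ K)
    {p : ℕ → ℝ[X]} (hp : ∀ j ≤ m, (p j).degree < (n j : WithBot ℕ)) (t : ℕ) :
    ∀ s : List ℕ, s.length + t = m + 1 → s.Nodup → (∀ k ∈ s, k ≤ m) → ∀ W : ℝ[X], W ≠ 0 →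
      RootsIn W (D.I s.length) → W.natDegree = ∑ j ∈ (Finset.range (m + 1)).filter (· ∉ s), n j →
      W ∣ D.G p s → ∀ j ≤ m, j ∉ s → p j = 0 := by
  induction t with
  | zero =>
    intro s hs hnd hm W hW0 hW hcard hdvd j hj hjs
    have := length_le_of_nodup (m := m) (List.nodup_cons.2 ⟨hjs, hnd⟩) (by
      rintro k hk
      rcases List.mem_cons.1 hk with rfl | hk
      exacts [hj, hm k hk])
    simp at this
    omega
  | succ t ih =>
    intro s hs hnd hm W hW0 hW hcard hdvd j hj hjs
    obtain ⟨k, hk, hmax⟩ := Finset.exists_max_image ((Finset.range (m + 1)).filter (· ∉ s))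
      (fun j => n j + if j < s.length + 1 then 1 else 0) ⟨j, by simp [hjs]; omega⟩
    simp only [Finset.mem_filter, Finset.mem_range] at hk hmax
    obtain ⟨hkm, hks⟩ := hk
    have hnd' : (k :: s).Nodup := List.nodup_cons.2 ⟨hks, hnd⟩
    have hm' : ∀ i ∈ k :: s, i ≤ m := by
      rintro i hi
      rcases List.mem_cons.1 hi with rfl | hi
      exacts [by omega, hm i hi]
    have hKm : m + 1 ≤ K := by omega
    have hfilter : (Finset.range (m + 1)).filter (· ∉ s) =
        insert k ((Finset.range (m + 1)).filter (· ∉ k :: s)) := by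
      ext i
      simp only [Finset.mem_filter, Finset.mem_range, Finset.mem_insert, List.mem_cons, not_or]
      by_cases hik : i = k
      · simp [hik, hkm, hks]
      · simp [hik]
    have hsum : ∑ j ∈ (Finset.range (m + 1)).filter (· ∉ s), n j =
        n k + ∑ j ∈ (Finset.range (m + 1)).filter (· ∉ k :: s), n j := by
      rw [hfilter, Finset.sum_insert (by simp)]
    set M := ∑ j ∈ (Finset.range (m + 1)).filter (· ∉ k :: s), n j with hM
    rw [hsum] at hcard
    obtain ⟨Y, c, w, hc, hY, hN, hYcard, hw, hres⟩ := hasWeights (D := D) hKm hnd' hm'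
    have hdisj := D.disjoint_I s.length
    -- the degree of the linear form
    have hdeg : (D.G p s).degree < ((n k + Y.card : ℕ) : WithBot ℕ) := by
      refine (degree_sum_le _ _).trans_lt ((Finset.sup_lt_iff (WithBot.bot_lt_coe _)).2 fun i hi => ?_)
      have him : i ≤ m := Nat.lt_succ_iff.1 (Finset.mem_range.1 hi)
      by_cases his : i ∈ s
      · rw [D.N_eq_zero_of_mem his, mul_zero, degree_zero]
        exact WithBot.bot_lt_coe _
      by_cases hpi : p i = 0
      · rw [hpi, zero_mul, degree_zero]
        exact WithBot.bot_lt_coe _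
      by_cases hNi : D.N (i :: s) = 0
      · rw [hNi, mul_zero, degree_zero]
        exact WithBot.bot_lt_coe _
      have h1 := D.natDegree_N_le hKm (l := i :: s) (by simp; omega) (by
        rintro k hk
        rcases List.mem_cons.1 hk with rfl | hk
        exacts [him, hm k hk])
      have h2 := hmax i ⟨by omega, his⟩
      have h3 := (natDegree_lt_iff_degree_lt hpi).2 (hp i him)
      rw [degree_eq_natDegree (mul_ne_zero hpi hNi), natDegree_mul hpi hNi, Nat.cast_lt]
      simp only [List.length_cons, List.countP_cons, decide_eq_true_eq] at h1 hYcard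
      omega
    -- zeros of the next linear form
    obtain ⟨R', hR', hR'card, hvan'⟩ : ∃ R' : Finset ℝ, (R' : Set ℝ) ⊆ D.I (s.length + 1) ∧ R'.card = M ∧
        ∀ x ∈ R', (D.G p (k :: s)).eval x = 0 := by
      rcases Nat.eq_zero_or_pos M with hM0 | hMpos
      · exact ⟨∅, by simp, by simp [hM0], by simp⟩
      have hYM : M ≤ Y.card := by
        have hlt : s.length + 1 ≤ m := by
          by_contra hcon
          obtain ⟨i, hi, -⟩ := Finset.exists_ne_zero_of_sum_ne_zero (hM ▸ hMpos.ne')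
          simp only [Finset.mem_filter, Finset.mem_range] at hi
          have := length_le_of_nodup (m := m) (List.nodup_cons.2 ⟨hi.2, hnd'⟩) (by
            rintro k hk
            rcases List.mem_cons.1 hk with rfl | hk
            exacts [by omega, hm' k hk])
          simp at this
          omega
        have h1 := D.le_card (s.length + 1) (by omega) hlt
        have h2 : M ≤ ∑ j ∈ Finset.range (m + 1), n j :=
          Finset.sum_le_sum_of_subset (Finset.filter_subset _ _)
        omega
      suffices h : ∃ R' : Finset ℝ, (R' : Set ℝ) ⊆ D.I (s.length + 1) ∧ M ≤ R'.card ∧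
          ∀ x ∈ R', (D.G p (k :: s)).eval x = 0 by
        obtain ⟨R', h1, h2, h3⟩ := h
        obtain ⟨R'', h4, h5⟩ := Finset.exists_subset_card_eq h2
        exact ⟨R'', (Finset.coe_subset.2 h4).trans h1, h5, fun x hx => h3 x (h4 hx)⟩
      by_cases hG0 : D.G p (k :: s) = 0
      · exact ⟨Y, hY, hYM, by simp [hG0]⟩
      obtain ⟨R', hR', e, he, hsign⟩ := exists_sign_changes (D.ordConnected (s.length + 1))
        (f := fun x => (D.G p (k :: s)).eval x) (Polynomial.continuousOn _)
        ((D.G p (k :: s)).roots.toFinset.finite_toSet.subset fun x hx => by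
          simp only [Finset.mem_coe, Multiset.mem_toFinset]
          exact (mem_roots hG0).2 hx.2)
      by_cases hcardR : M ≤ R'.card
      · exact ⟨R', fun x hx => interior_subset (hR' hx).1, hcardR, fun x hx => (hR' hx).2⟩
      refine ⟨Y, hY, hYM, fun ζ hζ => ?_⟩
      obtain ⟨H, hH⟩ := hdvd
      have hnodal : ∀ ζ ∈ D.I (s.length + 1), W.eval ζ ≠ 0 := fun ζ hζ => hW.eval_ne_zero fun h =>
        Set.disjoint_left.1 hdisj h hζ
      have hzero := sum_div_derivative_eq_zero Y (B := H * Lagrange.nodal R' id) (by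
        by_cases hH0 : H = 0
        · simp [hH0]
        right
        rw [natDegree_mul hH0 Lagrange.nodal_ne_zero, Lagrange.natDegree_nodal]
        have hGs : D.G p s ≠ 0 := by
          rw [hH]; exact mul_ne_zero hW0 hH0
        have := (natDegree_lt_iff_degree_lt hGs).2 hdeg
        rw [hH, natDegree_mul hW0 hH0] at this
        omega)
      have hterm : ∀ ζ ∈ Y, (H * Lagrange.nodal R' id).eval ζ / (derivative (Lagrange.nodal Y id)).eval ζ =
          w ζ * c / W.eval ζ *
            ((D.G p (k :: s)).eval ζ * (Lagrange.nodal R' id).eval ζ) := by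
        intro ζ hζ
        have h1 := eval_derivative_nodal_ne_zero hζ
        have h2 := hnodal ζ (hY hζ)
        have h3 : (D.G p s).eval ζ = w ζ * (c * (derivative (Lagrange.nodal Y id)).eval ζ) *
            (D.G p (k :: s)).eval ζ := by
          simp only [G, eval_finsetSum, eval_mul, Finset.mul_sum]
          refine Finset.sum_congr rfl fun i hi => ?_
          rw [hres ζ hζ i (Nat.lt_succ_iff.1 (Finset.mem_range.1 hi)), hN]
          simp only [derivative_mul, derivative_C, zero_mul, zero_add, eval_mul, eval_C]
          ring
        rw [hH, eval_mul] at h3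
        rw [eval_mul]
        field_simp
        linear_combination (Lagrange.nodal R' id).eval ζ * h3
      rw [Finset.sum_congr rfl hterm] at hzero
      obtain ⟨e', he'⟩ : SameSign (Y : Set ℝ) fun ζ => w ζ * c / W.eval ζ := by
        refine (hw.mul (sameSign_const _ hc)).div ?_
        exact (sameSign_of_continuousOn (D.ordConnected (s.length + 1)) (Polynomial.continuousOn _)
          hnodal).mono hY
      have hnn : ∀ ζ ∈ Y, 0 ≤ (e' * (w ζ * c / W.eval ζ)) *
          (e * ((D.G p (k :: s)).eval ζ * (Lagrange.nodal R' id).eval ζ)) := fun ζ hζ =>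
        mul_nonneg (he' ζ hζ).le (hsign ζ (hY hζ))
      have hz2 := (Finset.sum_eq_zero_iff_of_nonneg hnn).1 (by
        rw [← mul_zero (e' * e), ← hzero, Finset.mul_sum]
        exact Finset.sum_congr rfl fun ζ _ => by ring) ζ hζ
      have hz3 := (mul_eq_zero.1 ((mul_eq_zero.1 hz2).resolve_left (he' ζ hζ).ne')).resolve_left he
      rcases mul_eq_zero.1 hz3 with h | h
      · exact h
      · by_contra hcon
        exact eval_nodal_ne_zero (fun hmem => hcon (hR' hmem).2) h
    have hrest : ∀ j ≤ m, j ∉ k :: s → p j = 0 :=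
      ih (k :: s) (by simp; omega) hnd' hm' (Lagrange.nodal R' id) Lagrange.nodal_ne_zero
        (rootsIn_nodal hR') (by rw [Lagrange.natDegree_nodal, hR'card]) (nodal_dvd hvan')
    have hpk : p k = 0 := by
      have h2 : D.G p s = p k * D.N (k :: s) := by
        refine Finset.sum_eq_single k (fun i hi hik => ?_) (by simp; omega)
        by_cases his : i ∈ s
        · rw [D.N_eq_zero_of_mem his, mul_zero]
        · rw [hrest i (Nat.lt_succ_iff.1 (Finset.mem_range.1 hi)) (by simp [hik, his]), zero_mul]
      rw [h2] at hdvd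
      have h3 : W ∣ p k := (hW _ fun x hx =>
        ((hasRealZeros (D := D) hKm hnd' hm').sameSign (i := s.length) rfl).ne_zero hx).dvd_of_dvd_mul_right hdvd
      refine eq_zero_of_dvd_of_degree_lt h3 ((hp k (by omega)).trans_le ?_)
      rw [degree_eq_natDegree hW0, hcard]
      exact_mod_cast Nat.le_add_right _ _
    by_cases hjk : j = k
    · rw [hjk, hpk]
    · exact hrest j hj (by simp [hjk, hjs])

/-- The polynomials `f 0 k` form a discrete analogue of an algebraic Chebyshev system on `I 0`. -/
theorem eq_zero_of_dvd {n : ℕ → ℕ} (hK : m + 1 + ∑ j ∈ Finset.range (m + 1), n j ≤ K)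
    {p : ℕ → ℝ[X]} (hp : ∀ j ≤ m, (p j).degree < (n j : WithBot ℕ)) {W : ℝ[X]} (hW0 : W ≠ 0)
    (hW : RootsIn W (D.I 0)) (hdeg : W.natDegree = ∑ j ∈ Finset.range (m + 1), n j)
    (hdvd : W ∣ ∑ j ∈ Finset.range (m + 1), p j * D.f 0 j) : ∀ j ≤ m, p j = 0 := by
  intro j hj
  refine eq_zero_of_vanishing (D := D) hK hp (m + 1) [] (by simp) List.nodup_nil (by simp) W hW0 hW
    (by simpa using hdeg) ?_ j hj (by simp)
  convert hdvd using 1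
  exact Finset.sum_congr rfl fun i _ => congrArg (p i * ·) (D.N_cons_downList 0 i (by omega))

end DiscreteNikishin

/-- The indices of the coefficients of polynomials of degrees less than `n 0, …, n m`. -/
abbrev CoeffIdx (m : ℕ) (n : ℕ → ℕ) : Type := (j : Fin (m + 1)) × Fin (n j)

section Coefficients

variable {m : ℕ} {n : ℕ → ℕ}

/-- The polynomials with the given coefficients. -/
def toPoly (v : CoeffIdx m n → ℝ) (j : ℕ) : ℝ[X] :=
  if h : j < m + 1 then ∑ i : Fin (n j), C (v ⟨⟨j, h⟩, i⟩) * X ^ (i : ℕ) else 0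

theorem degree_toPoly_lt (v : CoeffIdx m n → ℝ) (j : ℕ) : (toPoly v j).degree < (n j : WithBot ℕ) := by
  unfold toPoly
  split_ifs with h
  · exact degree_sum_fin_lt fun i => v ⟨⟨j, h⟩, i⟩
  · simp

theorem eq_zero_of_toPoly {v : CoeffIdx m n → ℝ} (h : ∀ j ≤ m, toPoly v j = 0) : v = 0 := by
  funext ⟨⟨j, hj⟩, i⟩
  have h1 := congrArg (fun p => p.coeff (i : ℕ)) (h j (by omega))
  simp only [toPoly, hj, dif_pos, finsetSum_coeff, coeff_C_mul, coeff_X_pow, coeff_zero] at h1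
  rw [Finset.sum_eq_single i] at h1
  · simpa using h1
  · intro b _ hb
    rw [if_neg fun e => hb (Fin.ext e).symm, mul_zero]
  · simp

theorem sum_toPoly_mul (v : CoeffIdx m n → ℝ) (f : ℕ → ℝ[X]) :
    ∑ j ∈ Finset.range (m + 1), toPoly v j * f j = ∑ q, C (v q) * X ^ (q.2 : ℕ) * f q.1 := by
  rw [Finset.sum_range, Fintype.sum_sigma]
  refine Finset.sum_congr rfl fun j _ => ?_
  rw [toPoly, dif_pos j.2, Finset.sum_mul]

theorem sum_toPoly_eval_mul (v : CoeffIdx m n → ℝ) (u : ℕ → ℝ) (x : ℝ) :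
    ∑ j ∈ Finset.range (m + 1), (toPoly v j).eval x * u j = ∑ q, v q * x ^ (q.2 : ℕ) * u q.1 := by
  rw [Finset.sum_range, Fintype.sum_sigma]
  refine Finset.sum_congr rfl fun j _ => ?_
  rw [toPoly, dif_pos j.2, eval_finsetSum, Finset.sum_mul]
  simp

theorem card_coeffIdx : Fintype.card (CoeffIdx m n) = ∑ j ∈ Finset.range (m + 1), n j := by
  rw [Fintype.card_sigma, Finset.sum_range]
  simp

end Coefficients

namespace DiscreteNikishin

variable {m K : ℕ} {D : DiscreteNikishin m K}

/-- There is a nontrivial linear form, normalized to unit coefficient norm, changing sign exactly at the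
given points. -/
theorem exists_coeff_sign {n : ℕ → ℕ} (hK : m + 1 + ∑ j ∈ Finset.range (m + 1), n j ≤ K) {a b : ℝ}
    (hab : a ≤ b) (hI : D.I 0 = Icc a b) {R : Finset ℝ} (hR : (R : Set ℝ) ⊆ Icc a b)
    (hcard : R.card < ∑ j ∈ Finset.range (m + 1), n j) :
    ∃ v : CoeffIdx m n → ℝ, ‖v‖ = 1 ∧ ∀ x ∈ Icc a b, 0 ≤
      (∑ q, v q * x ^ (q.2 : ℕ) * ((D.f 0 q.1).eval x / (D.A 1).eval x)) *
        (Lagrange.nodal R id).eval x := by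
  set M := ∑ j ∈ Finset.range (m + 1), n j with hM
  set W : ℝ[X] := Lagrange.nodal R id * (X - C a) ^ (M - 1 - R.card) with hWdef
  have hWm : W.Monic := Lagrange.nodal_monic.mul ((monic_X_sub_C a).pow _)
  have hWdeg : W.natDegree = M - 1 := by
    rw [hWdef, Lagrange.nodal_monic.natDegree_mul ((monic_X_sub_C a).pow _), Lagrange.natDegree_nodal,
      natDegree_pow, natDegree_X_sub_C]
    omega
  have hWr : RootsIn W (D.I 0) := by
    rw [hI]
    exact (rootsIn_nodal hR).mul ((rootsIn_X_sub_C (left_mem_Icc.2 hab)).pow _)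
  let G : (CoeffIdx m n → ℝ) →ₗ[ℝ] ℝ[X] :=
    Fintype.linearCombination ℝ fun q => X ^ (q.2 : ℕ) * D.f 0 q.1
  have hG : ∀ v, G v = ∑ q, C (v q) * X ^ (q.2 : ℕ) * D.f 0 q.1 := fun v => by
    simp [G, Fintype.linearCombination_apply, smul_eq_C_mul, mul_assoc]
  let T : (CoeffIdx m n → ℝ) →ₗ[ℝ] (Fin (M - 1) → ℝ) :=
    LinearMap.pi fun i => lcoeff ℝ (i : ℕ) ∘ₗ modByMonicHom W ∘ₗ G
  obtain ⟨v, hv, hv0⟩ := (Submodule.ne_bot_iff _).1 (LinearMap.ker_ne_bot_of_finrank_lt (f := T) (by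
    rw [Module.finrank_fintype_fun_eq_card, Module.finrank_fintype_fun_eq_card, card_coeffIdx,
      Fintype.card_fin]
    omega))
  have hmod : G v %ₘ W = 0 := by
    ext i
    rw [coeff_zero]
    by_cases hi : i < M - 1
    · exact congrFun (LinearMap.mem_ker.1 hv) ⟨i, hi⟩
    · refine coeff_eq_zero_of_degree_lt ((degree_modByMonic_lt _ hWm).trans_le ?_)
      rw [degree_eq_natDegree hWm.ne_zero, hWdeg]
      exact_mod_cast not_lt.1 hi
  obtain ⟨H, hH⟩ := (modByMonic_eq_zero_iff_dvd hWm).1 hmod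
  have hHne : ∀ x ∈ Icc a b, H.eval x ≠ 0 := by
    intro x hx h0
    obtain ⟨H', hH'⟩ := dvd_iff_isRoot.2 h0
    refine hv0 (eq_zero_of_toPoly (eq_zero_of_dvd (D := D) hK (fun j _ => degree_toPoly_lt v j)
      (W := W * (X - C x)) (mul_ne_zero hWm.ne_zero (X_sub_C_ne_zero x))
      (hWr.mul (rootsIn_X_sub_C (hI ▸ hx))) ?_ ?_))
    · rw [hWm.natDegree_mul (monic_X_sub_C x), hWdeg, natDegree_X_sub_C]
      omega
    · rw [sum_toPoly_mul, ← hG, hH, hH']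
      exact ⟨H', by ring⟩
  have hA : ∀ x ∈ Icc a b, (D.A 1).eval x ≠ 0 := fun x hx => eval_nodal_ne_zero fun h =>
    Set.disjoint_left.1 (D.disjoint_I 0) (hI ▸ hx) (D.subset_I 1 h)
  obtain ⟨e, he⟩ := (sameSign_of_continuousOn ordConnected_Icc (Polynomial.continuousOn _) hHne).div
    (sameSign_of_continuousOn ordConnected_Icc (Polynomial.continuousOn _) hA)
  have he0 : e ≠ 0 := by
    rintro rfl
    simpa using he a (left_mem_Icc.2 hab)
  have hvn : 0 < ‖v‖ := norm_pos_iff.2 hv0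
  have hen : 0 < |e| := abs_pos.2 he0
  refine ⟨(e / (|e| * ‖v‖)) • v, ?_, fun x hx => ?_⟩
  · rw [norm_smul, norm_div, norm_mul, norm_norm, Real.norm_eq_abs, Real.norm_eq_abs, abs_abs]
    field_simp
  have h1 : ∑ q, ((e / (|e| * ‖v‖)) • v) q * x ^ (q.2 : ℕ) * ((D.f 0 q.1).eval x / (D.A 1).eval x) =
      (e / (|e| * ‖v‖)) / (D.A 1).eval x * (G v).eval x := by
    rw [hG, eval_finsetSum, Finset.mul_sum]
    refine Finset.sum_congr rfl fun q _ => ?_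
    simp only [Pi.smul_apply, smul_eq_mul, eval_mul, eval_C, eval_pow, eval_X]
    ring
  rw [h1, hH, eval_mul, hWdef, eval_mul, eval_pow, eval_sub, eval_X, eval_C]
  have h2 : e / (|e| * ‖v‖) / (D.A 1).eval x *
      ((Lagrange.nodal R id).eval x * (x - a) ^ (M - 1 - R.card) * H.eval x) *
        (Lagrange.nodal R id).eval x = (|e| * ‖v‖)⁻¹ * (e * (H.eval x / (D.A 1).eval x)) *
        ((x - a) ^ (M - 1 - R.card) * (Lagrange.nodal R id).eval x ^ 2) := by ring
  rw [h2]
  exact mul_nonneg (mul_nonneg (inv_nonneg.2 (by positivity)) (he x hx).le)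
    (mul_nonneg (pow_nonneg (sub_nonneg.2 hx.1) _) (sq_nonneg _))

end DiscreteNikishin

/-- The iterated Cauchy transforms of a sequence of discrete measures, where the measure of level `j` has
the atoms `Z j` with the weights `w j`. -/
def discreteIter (Z : ℕ → Finset ℝ) (w : ℕ → ℝ → ℝ) : ℕ → ℕ → ℝ → ℝ
  | 0, _, _ => 1
  | d + 1, j, x => ∑ a ∈ Z j, w j a * (discreteIter Z w d (j + 1) a / (x - a))

theorem discreteIter_congr {Z Z' : ℕ → Finset ℝ} {w w' : ℕ → ℝ → ℝ} (d : ℕ) :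
    ∀ j, (∀ i, j ≤ i → Z i = Z' i ∧ w i = w' i) → discreteIter Z w d j = discreteIter Z' w' d j := by
  induction d with
  | zero => exact fun j _ => funext fun x => by rw [discreteIter, discreteIter]
  | succ d ih =>
    intro j h
    funext x
    rw [discreteIter, discreteIter, ih (j + 1) fun i hi => h i (by omega), (h j le_rfl).1, (h j le_rfl).2]

section Construction

variable (Z : ℕ → Finset ℝ) (w : ℕ → ℝ → ℝ)

/-- The polynomial form of the iterated Cauchy transforms of discrete measures. -/
def iterPoly (i k : ℕ) : ℝ[X] :=
  if i < k then ∑ a ∈ Z (i + 1), C (w (i + 1) a * discreteIter Z w (k - i - 1) (i + 2) a) *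
    Lagrange.nodal ((Z (i + 1)).erase a) id
  else if i = k then Lagrange.nodal (Z (i + 1)) id else 0

variable {Z w}

theorem eval_iterPoly {i k : ℕ} (hik : i ≤ k) {x : ℝ} (hx : x ∉ Z (i + 1)) :
    (iterPoly Z w i k).eval x =
      (Lagrange.nodal (Z (i + 1)) id).eval x * discreteIter Z w (k - i) (i + 1) x := by
  rcases hik.lt_or_eq with h | rfl
  · rw [iterPoly, if_pos h, show k - i = k - i - 1 + 1 by omega, discreteIter, eval_finsetSum,
      Finset.mul_sum]
    refine Finset.sum_congr rfl fun a ha => ?_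
    have hxa : x - a ≠ 0 := sub_ne_zero.2 fun e => hx (e ▸ ha)
    rw [Lagrange.nodal_eq_mul_nodal_erase ha]
    simp only [eval_mul, eval_C, eval_sub, eval_X, id, Nat.add_sub_cancel]
    field_simp
  · rw [iterPoly, if_neg (lt_irrefl _), if_pos rfl, Nat.sub_self, discreteIter, mul_one]

theorem eval_iterPoly_of_mem {i k : ℕ} (hik : i < k) {a : ℝ} (ha : a ∈ Z (i + 1)) :
    (iterPoly Z w i k).eval a = w (i + 1) a * (derivative (Lagrange.nodal (Z (i + 1)) id)).eval a *
      discreteIter Z w (k - i - 1) (i + 2) a := by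
  have h1 := Lagrange.eval_nodal_derivative_eval_node_eq (v := id) ha
  rw [id] at h1
  rw [h1, iterPoly, if_pos hik, eval_finsetSum, Finset.sum_eq_single a]
  · rw [eval_mul, eval_C]
    ring
  · intro b hb hba
    rw [eval_mul, eval_nodal_eq_zero (Finset.mem_erase.2 ⟨hba.symm, ha⟩), mul_zero]
  · exact fun h => absurd ha h

theorem natDegree_iterPoly_le {i k : ℕ} (h : i < k → (Z (i + 1)).Nonempty) :
    (iterPoly Z w i k).natDegree + 1 ≤ (Z (i + 1)).card + if k ≤ i then 1 else 0 := by
  rcases lt_trichotomy i k with hik | rfl | hik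
  · rw [iterPoly, if_pos hik, if_neg (by omega)]
    have hpos := Finset.card_pos.2 (h hik)
    suffices hs : (∑ a ∈ Z (i + 1), C (w (i + 1) a * discreteIter Z w (k - i - 1) (i + 2) a) *
        Lagrange.nodal ((Z (i + 1)).erase a) id).natDegree ≤ (Z (i + 1)).card - 1 by omega
    refine natDegree_sum_le_of_forall_le _ _ fun a ha => (natDegree_C_mul_le _ _).trans ?_
    rw [Lagrange.natDegree_nodal, Finset.card_erase_of_mem ha]
  · simp [iterPoly]
  · rw [iterPoly, if_neg (by omega), if_neg (by omega), if_pos hik.le, natDegree_zero]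
    omega

/-- The discrete Nikishin system with given atoms and weights. -/
def DiscreteNikishin.mk' {m K : ℕ} (hK : 1 ≤ K) (I : ℕ → Set ℝ) (ordConnected : ∀ i, (I i).OrdConnected)
    (disjoint_I : ∀ i, Disjoint (I i) (I (i + 1))) (subset_I : ∀ i, (Z i : Set ℝ) ⊆ I i)
    (disjoint_Z : ∀ i j, i ≠ j → Disjoint (Z i) (Z j)) (Z_zero : Z 0 = ∅) (Z_top : Z (m + 1) = ∅)
    (le_card : ∀ i, 1 ≤ i → i ≤ m → K ≤ (Z i).card) (w_pos : ∀ i, ∀ a ∈ Z i, 0 < w i a) :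
    DiscreteNikishin m K where
  I := I
  Z := Z
  w := w
  f := iterPoly Z w
  ordConnected := ordConnected
  disjoint_I := disjoint_I
  subset_I := subset_I
  disjoint_Z := disjoint_Z
  Z_zero := Z_zero
  Z_top := Z_top
  le_card := le_card
  sameSign i := SameSign.pos fun a ha => w_pos i a ha
  f_diag i _ := by rw [iterPoly, if_neg (lt_irrefl _), if_pos rfl]
  f_lower i k h := by rw [iterPoly, if_neg (by omega), if_neg (by omega)]
  f_degree i _ k _ := natDegree_iterPoly_le fun _ =>
    Finset.card_pos.1 (hK.trans (le_card (i + 1) (by omega) (by omega)))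
  f_eval i k a ha := by
    rcases lt_trichotomy i k with hik | rfl | hik
    · rw [eval_iterPoly_of_mem hik ha, eval_iterPoly hik
        (Finset.disjoint_left.1 (disjoint_Z (i + 1) (i + 2) (by omega)) ha), Nat.sub_sub]
      ring
    · rw [iterPoly, if_neg (lt_irrefl _), if_pos rfl, eval_nodal_eq_zero ha, iterPoly,
        if_neg (by omega), if_neg (by omega)]
      simp
    · rw [iterPoly, if_neg (by omega), if_neg (by omega), iterPoly, if_neg (by omega),
        if_neg (by omega)]
      simp

end Construction

theorem ae_mem_of_compl_eq_zero {μ : Measure ℝ} {s : Set ℝ} (h : μ sᶜ = 0) : ∀ᵐ t ∂μ, t ∈ s :=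
  mem_ae_iff.2 h

theorem integrable_of_continuousOn {μ : Measure ℝ} [IsFiniteMeasure μ] {s : Set ℝ} (hs : IsCompact s)
    (hμ : μ sᶜ = 0) {E : Type*} [NormedAddCommGroup E] {φ : ℝ → E} (hφ : ContinuousOn φ s) : Integrable φ μ := by
  have := hφ.integrableOn_compact (μ := μ) hs
  rwa [IntegrableOn, Measure.restrict_eq_self_of_ae_mem (ae_mem_of_compl_eq_zero hμ)] at this

theorem continuousOn_integral_div_sub {μ : Measure ℝ} [IsFiniteMeasure μ] {s : Set ℝ} (hs : IsCompact s)
    (hμ : μ sᶜ = 0) {φ : ℝ → ℝ} (hφ : ContinuousOn φ s) :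
    ContinuousOn (fun x => ∫ t, φ t / (x - t) ∂μ) sᶜ := by
  intro x hx
  refine ContinuousAt.continuousWithinAt ?_
  obtain ⟨δ, hδ, hball⟩ := Metric.isOpen_iff.1 hs.isClosed.isOpen_compl x hx
  have hdist : ∀ y ∈ Metric.ball x (δ / 2), ∀ t ∈ s, δ / 2 ≤ |y - t| := by
    intro y hy t ht
    by_contra! hlt
    refine hball (?_ : t ∈ Metric.ball x δ) ht
    rw [Metric.mem_ball, Real.dist_eq] at hy ⊢
    have := abs_sub_le t y x
    rw [abs_sub_comm t y] at this
    linarith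
  have hae := ae_mem_of_compl_eq_zero hμ
  refine continuousAt_of_dominated (bound := fun t => |φ t| / (δ / 2)) ?_ ?_ ?_ ?_
  · filter_upwards [Metric.ball_mem_nhds x (half_pos hδ)] with y hy
    refine (integrable_of_continuousOn hs hμ (hφ.div (by fun_prop) fun t ht h0 => ?_)).aestronglyMeasurable
    have := hdist y hy t ht
    rw [h0, abs_zero] at this
    linarith
  · filter_upwards [Metric.ball_mem_nhds x (half_pos hδ)] with y hy
    filter_upwards [hae] with t ht
    rw [Real.norm_eq_abs, abs_div]
    exact div_le_div_of_nonneg_left (abs_nonneg _) (half_pos hδ) (hdist y hy t ht)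
  · exact (integrable_of_continuousOn hs hμ hφ.abs).div_const _
  · filter_upwards [hae] with t ht
    refine continuousAt_const.div (by fun_prop) (sub_ne_zero.2 ?_)
    rintro rfl
    exact hx ht

/-- The discrete measure with atoms `Z` and weights `w` integrates functions of small oscillation at
the scale `h` almost as `μ` does. -/
def ApproximatesAt (μ : Measure ℝ) (a b h : ℝ) (Z : Finset ℝ) (w : ℝ → ℝ) : Prop :=
  ∀ (φ : ℝ → ℝ) (ε B : ℝ), ContinuousOn φ (Icc a b) →
    (∀ s ∈ Icc a b, ∀ t ∈ Icc a b, |s - t| ≤ h → |φ s - φ t| ≤ ε) →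
    (∀ t ∈ Icc a b, |φ t| ≤ B) → |∑ z ∈ Z, w z * φ z - ∫ t, φ t ∂μ| ≤ ε * μ.real univ + h * B

/-- A finite measure on an interval is approximated by discrete measures with arbitrarily many atoms. -/
theorem exists_discretization {μ : Measure ℝ} [IsFiniteMeasure μ] {a b : ℝ} (hab : a < b)
    (hμ : μ (Icc a b)ᶜ = 0) (F : Finset ℝ) (K : ℕ) {h : ℝ} (hh : 0 < h) :
    ∃ (Z : Finset ℝ) (w : ℝ → ℝ), (Z : Set ℝ) ⊆ Icc a b ∧ Disjoint Z F ∧ K ≤ Z.card ∧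
      (∀ z ∈ Z, 0 < w z) ∧ ApproximatesAt μ a b h Z w := by
  have hclos : Icc a b ⊆ closure (Ioo a b ∩ (F : Set ℝ)ᶜ) := by
    have h1 : Dense ((F : Set ℝ)ᶜ) := by
      rw [compl_eq_univ_sdiff]
      exact dense_univ.sdiff_finset F
    have h2 := h1.open_subset_closure_inter (isOpen_Ioo (a := a) (b := b))
    rw [← closure_Ioo hab.ne]
    exact closure_minimal h2 isClosed_closure
  have hinf : (Ioo a b ∩ (F : Set ℝ)ᶜ).Infinite := (Ioo_infinite hab).sdiff F.finite_toSet
  have htag : ∀ i : ℤ, ∃ z ∈ Ioo a b ∩ (F : Set ℝ)ᶜ, ∀ t ∈ Icc a b, ⌊t / (h / 2)⌋ = i → |t - z| ≤ h := by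
    intro i
    by_cases hi : ∃ t ∈ Icc a b, ⌊t / (h / 2)⌋ = i
    · obtain ⟨t, ht, rfl⟩ := hi
      obtain ⟨z, hz, hzt⟩ := Metric.mem_closure_iff.1 (hclos ht) (h / 2) (half_pos hh)
      refine ⟨z, hz, fun s hs hst => ?_⟩
      have h1 := Int.abs_sub_lt_one_of_floor_eq_floor hst
      rw [← sub_div, abs_div, abs_of_pos (half_pos hh), div_lt_one (half_pos hh)] at h1
      rw [Real.dist_eq] at hzt
      have := abs_sub_le s t z
      linarith
    · obtain ⟨z, hz⟩ := hinf.nonempty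
      exact ⟨z, hz, fun t ht hti => absurd ⟨t, ht, hti⟩ hi⟩
  choose τ hτS hτ using htag
  obtain ⟨Y, hYS, hYK⟩ := hinf.exists_subset_card_eq K
  set f : ℝ → ℝ := fun t => τ ⌊t / (h / 2)⌋ with hf
  have hfm : Measurable f := (measurable_from_top (f := τ)).comp (Int.measurable_floor.comp (by fun_prop))
  set Z : Finset ℝ := (Finset.Icc ⌊a / (h / 2)⌋ ⌊b / (h / 2)⌋).image τ ∪ Y with hZ
  have hfZ : ∀ t ∈ Icc a b, f t ∈ Z := fun t ht => Finset.mem_union_left _ (Finset.mem_image_of_mem _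
    (Finset.mem_Icc.2 ⟨Int.floor_mono (by gcongr; exact ht.1), Int.floor_mono (by gcongr; exact ht.2)⟩))
  have hZS : ∀ z ∈ Z, z ∈ Ioo a b ∩ (F : Set ℝ)ᶜ := by
    intro z hz
    rcases Finset.mem_union.1 hz with hz | hz
    · obtain ⟨i, -, rfl⟩ := Finset.mem_image.1 hz
      exact hτS i
    · exact hYS hz
  set η : ℝ := h / (Z.card + 1) with hη
  have hηpos : 0 < η := by positivity
  refine ⟨Z, fun z => μ.real (f ⁻¹' {z}) + η, fun z hz => Ioo_subset_Icc_self (hZS z hz).1,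
    Finset.disjoint_left.2 fun z hz hzF => (hZS z hz).2 hzF, ?_, fun z _ => by positivity, ?_⟩
  · rw [← hYK]
    exact Finset.card_le_card Finset.subset_union_right
  intro φ ε B hφ hosc hB
  have hB0 : 0 ≤ B := (abs_nonneg _).trans (hB a (left_mem_Icc.2 hab.le))
  have hae := ae_mem_of_compl_eq_zero hμ
  have h_int : ∀ z ∈ Z, Integrable ((f ⁻¹' {z}).indicator fun _ => φ z) μ := fun z _ =>
    (integrable_const (φ z)).indicator (hfm (measurableSet_singleton z))
  have hsum : ∫ t, ∑ z ∈ Z, (f ⁻¹' {z}).indicator (fun _ => φ z) t ∂μ =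
      ∑ z ∈ Z, μ.real (f ⁻¹' {z}) * φ z := by
    rw [integral_finsetSum _ h_int]
    refine Finset.sum_congr rfl fun z _ => ?_
    rw [integral_indicator_const _ (hfm (measurableSet_singleton z)), smul_eq_mul]
  have hval : ∀ t ∈ Icc a b, ∑ z ∈ Z, (f ⁻¹' {z}).indicator (fun _ => φ z) t = φ (f t) := by
    intro t ht
    rw [Finset.sum_eq_single (f t)]
    · rw [indicator_of_mem (by simp)]
    · intro z _ hz
      rw [indicator_of_notMem]
      exact fun h => hz (by simpa using h.symm)
    · exact fun h => absurd (hfZ t ht) h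
  have h1 : |∑ z ∈ Z, μ.real (f ⁻¹' {z}) * φ z - ∫ t, φ t ∂μ| ≤ ε * μ.real univ := by
    rw [← hsum, ← integral_sub (integrable_finsetSum _ h_int) (integrable_of_continuousOn isCompact_Icc hμ hφ),
      ← Real.norm_eq_abs]
    refine norm_integral_le_of_norm_le_const ?_
    filter_upwards [hae] with t ht
    rw [hval t ht, Real.norm_eq_abs]
    refine hosc _ (Ioo_subset_Icc_self (hZS _ (hfZ t ht)).1) t ht ?_
    rw [abs_sub_comm]
    exact hτ _ t ht rfl
  have h2 : |∑ z ∈ Z, η * φ z| ≤ h * B := by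
    calc |∑ z ∈ Z, η * φ z| ≤ ∑ z ∈ Z, η * B := (Finset.abs_sum_le_sum_abs _ _).trans
          (Finset.sum_le_sum fun z hz => by
            rw [abs_mul, abs_of_pos hηpos]
            exact mul_le_mul_of_nonneg_left (hB z (Ioo_subset_Icc_self (hZS z hz).1)) hηpos.le)
      _ = Z.card / (Z.card + 1) * (h * B) := by
          rw [Finset.sum_const, nsmul_eq_mul, hη]
          ring
      _ ≤ 1 * (h * B) := mul_le_mul_of_nonneg_right (div_le_one_of_le₀ (by linarith) (by positivity))
          (mul_nonneg hh.le hB0)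
      _ = h * B := one_mul _
  have h3 : ∑ z ∈ Z, (μ.real (f ⁻¹' {z}) + η) * φ z - ∫ t, φ t ∂μ =
      (∑ z ∈ Z, μ.real (f ⁻¹' {z}) * φ z - ∫ t, φ t ∂μ) + ∑ z ∈ Z, η * φ z := by
    simp only [add_mul, Finset.sum_add_distrib]
    ring
  rw [h3]
  exact (abs_add_le _ _).trans (add_le_add h1 h2)

theorem exists_pos_le_abs_sub {s t : Set ℝ} (hs : IsCompact s) (ht : IsCompact t) (hst : Disjoint s t) :
    ∃ δ > 0, ∀ x ∈ s, ∀ y ∈ t, δ ≤ |x - y| := by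
  obtain ⟨r, hr, h⟩ := Metric.exists_pos_forall_lt_edist hs ht.isClosed hst
  refine ⟨r, hr, fun x hx y hy => ?_⟩
  have := h x hx y hy
  rw [edist_nndist, ENNReal.coe_lt_coe, ← NNReal.coe_lt_coe, coe_nndist, Real.dist_eq] at this
  exact this.le

theorem ApproximatesAt.sum_le {μ : Measure ℝ} {a b h : ℝ} {Z : Finset ℝ} {w : ℝ → ℝ}
    (H : ApproximatesAt μ a b h Z w) : ∑ z ∈ Z, w z ≤ μ.real univ + h := by
  have h1 := H (fun _ => 1) 0 1 continuousOn_const (by simp) (by simp)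
  simp only [mul_one, integral_const, smul_eq_mul, zero_mul, zero_add] at h1
  linarith [(abs_le.1 h1).2]

theorem eventually_abs_sum_sub_integral_le {μ : Measure ℝ} [IsFiniteMeasure μ] {a b : ℝ} {S : Set ℝ}
    (hS : IsCompact S) (hdisj : Disjoint S (Icc a b)) {g : ℝ → ℝ} (hg : ContinuousOn g (Icc a b)) {ε : ℝ}
    (hε : 0 < ε) : ∀ᶠ h in 𝓝[>] (0 : ℝ), ∀ Z w, ApproximatesAt μ a b h Z w → ∀ x ∈ S,
      |∑ z ∈ Z, w z * (g z / (x - z)) - ∫ t, g t / (x - t) ∂μ| ≤ ε := by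
  have hcont : ContinuousOn (fun q : ℝ × ℝ => g q.2 / (q.1 - q.2)) (S ×ˢ Icc a b) := by
    refine (hg.comp continuousOn_snd fun q hq => hq.2).div (by fun_prop) fun q hq => sub_ne_zero.2 ?_
    intro e
    exact Set.disjoint_left.1 hdisj hq.1 (e ▸ hq.2)
  have hcomp : IsCompact (S ×ˢ Icc a b) := hS.prod isCompact_Icc
  obtain ⟨B, hB⟩ := hcomp.exists_bound_of_continuousOn hcont
  set ε₁ := ε / (2 * (μ.real univ + 1)) with hε₁
  have hM : 0 ≤ μ.real univ := measureReal_nonneg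
  have hε₁pos : 0 < ε₁ := by positivity
  obtain ⟨δ, hδ, huc⟩ := Metric.uniformContinuousOn_iff.1
    (hcomp.uniformContinuousOn_of_continuous hcont) ε₁ hε₁pos
  have h1 : ∀ᶠ h in 𝓝[>] (0 : ℝ), h < δ := nhdsWithin_le_nhds (gt_mem_nhds hδ)
  have h2 : ∀ᶠ h in 𝓝[>] (0 : ℝ), h * B < ε / 2 := by
    refine nhdsWithin_le_nhds ?_
    have : Tendsto (fun h : ℝ => h * B) (𝓝 0) (𝓝 (0 * B)) := (continuous_mul_const B).tendsto 0
    rw [zero_mul] at this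
    exact this.eventually_lt_const (half_pos hε)
  filter_upwards [h1, h2] with h hhδ hhB Z w H x hx
  refine (H (fun t => g t / (x - t)) ε₁ B ?_ ?_ ?_).trans ?_
  · exact hcont.comp (f := fun t => (x, t)) (by fun_prop) fun t ht => ⟨hx, ht⟩
  · intro s hs t ht hst
    have := huc (x, s) ⟨hx, hs⟩ (x, t) ⟨hx, ht⟩ (by
      rw [Prod.dist_eq, dist_self, max_eq_right dist_nonneg, Real.dist_eq]
      exact hst.trans_lt hhδ)
    rw [Real.dist_eq] at this
    exact this.le
  · exact fun t ht => hB (x, t) ⟨hx, ht⟩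
  · have : ε₁ * μ.real univ ≤ ε / 2 := by
      rw [hε₁, div_mul_eq_mul_div, div_le_div_iff₀ (by positivity) (by positivity)]
      nlinarith
    linarith

/-- The iterated Cauchy transforms of a sequence of measures. -/
def cauchyIter (μ : ℕ → Measure ℝ) : ℕ → ℕ → ℝ → ℝ
  | 0, _, _ => 1
  | d + 1, j, x => ∫ t, cauchyIter μ d (j + 1) t / (x - t) ∂μ j

/-- Measures generating a Nikishin system, up to signs. -/
structure MeasureChain (m : ℕ) (μ : ℕ → Measure ℝ) (a b : ℕ → ℝ) : Prop where
  finite : ∀ j ≤ m, IsFiniteMeasure (μ j)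
  lt : ∀ j ≤ m, a j < b j
  compl : ∀ j ≤ m, μ j (Icc (a j) (b j))ᶜ = 0
  disjoint : ∀ j < m, Disjoint (Icc (a j) (b j)) (Icc (a (j + 1)) (b (j + 1)))
  infinite : ∀ j ≤ m, ∀ s : Set ℝ, s.Finite → μ j sᶜ ≠ 0

namespace MeasureChain

variable {m : ℕ} {μ : ℕ → Measure ℝ} {a b : ℕ → ℝ}

theorem continuousOn_cauchyIter_compl (H : MeasureChain m μ a b) (d : ℕ) :
    ∀ j, j + d ≤ m + 1 → ContinuousOn (cauchyIter μ d j) (Icc (a j) (b j))ᶜ := by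
  induction d with
  | zero => exact fun j _ => continuousOn_const (c := (1 : ℝ))
  | succ d ih =>
    intro j hj
    have := H.finite j (by omega)
    refine continuousOn_integral_div_sub isCompact_Icc (H.compl j (by omega)) ?_
    rcases Nat.eq_zero_or_pos d with rfl | hd
    · exact continuousOn_const (c := (1 : ℝ))
    · exact (ih (j + 1) (by omega)).mono fun x hx hx' =>
        Set.disjoint_left.1 (H.disjoint j (by omega)) hx hx'

theorem continuousOn_cauchyIter (H : MeasureChain m μ a b) {d j : ℕ} (h : j + d ≤ m) :
    ContinuousOn (cauchyIter μ d (j + 1)) (Icc (a j) (b j)) := by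
  rcases Nat.eq_zero_or_pos d with rfl | hd
  · exact continuousOn_const (c := (1 : ℝ))
  · exact (H.continuousOn_cauchyIter_compl d (j + 1) (by omega)).mono fun x hx hx' =>
      Set.disjoint_left.1 (H.disjoint j (by omega)) hx hx'

/-- Simultaneous discretization of the measures of the levels above `j`. -/
theorem exists_discreteIter (H : MeasureChain m μ a b) (K t : ℕ) : ∀ j, j + t = m → ∀ ε > 0,
    ∃ (Z : ℕ → Finset ℝ) (w : ℕ → ℝ → ℝ), (∀ i, ¬ (j < i ∧ i ≤ m) → Z i = ∅) ∧
      (∀ i, j < i → i ≤ m → (Z i : Set ℝ) ⊆ Icc (a i) (b i) ∧ K ≤ (Z i).card) ∧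
      (∀ i, ∀ z ∈ Z i, 0 < w i z) ∧ (∀ i i', i ≠ i' → Disjoint (Z i) (Z i')) ∧
      ∀ d, j + d ≤ m → ∀ x ∈ Icc (a j) (b j),
        |discreteIter Z w d (j + 1) x - cauchyIter μ d (j + 1) x| ≤ ε := by
  induction t with
  | zero =>
    rintro j hj ε hε
    refine ⟨fun _ => ∅, fun _ _ => 1, fun _ _ => rfl, fun i h1 h2 => by omega, by simp, by simp,
      fun d hd x _ => ?_⟩
    obtain rfl : d = 0 := by omega
    simpa [discreteIter, cauchyIter] using hε.le
  | succ t ih =>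
    intro j hj ε hε
    have hfin := H.finite (j + 1) (by omega)
    have hdisj := H.disjoint j (by omega)
    obtain ⟨δ, hδ, hdist⟩ := exists_pos_le_abs_sub isCompact_Icc isCompact_Icc hdisj
    set M := (μ (j + 1)).real univ
    have hM : 0 ≤ M := measureReal_nonneg
    obtain ⟨Z, w, hZ0, hZ, hw, hZd, happ⟩ := ih (j + 1) (by omega) (ε * δ / (2 * (M + 1))) (by positivity)
    have hev : ∀ᶠ h in 𝓝[>] (0 : ℝ), ∀ d ∈ Finset.range (m - j), ∀ Z' w',
        ApproximatesAt (μ (j + 1)) (a (j + 1)) (b (j + 1)) h Z' w' → ∀ x ∈ Icc (a j) (b j),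
        |∑ z ∈ Z', w' z * (cauchyIter μ d (j + 2) z / (x - z)) -
          ∫ t, cauchyIter μ d (j + 2) t / (x - t) ∂μ (j + 1)| ≤ ε / 2 := by
      rw [Filter.eventually_all_finset]
      intro d hd
      rw [Finset.mem_range] at hd
      exact eventually_abs_sum_sub_integral_le isCompact_Icc hdisj
        (H.continuousOn_cauchyIter (by omega)) (half_pos hε)
    have hev1 : ∀ᶠ h in 𝓝[>] (0 : ℝ), h < 1 := nhdsWithin_le_nhds (gt_mem_nhds one_pos)
    obtain ⟨h, ⟨hh, hh1⟩, hhpos⟩ := ((hev.and hev1).and self_mem_nhdsWithin).exists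
    obtain ⟨Z', w', hZ'I, hZ'F, hZ'K, hw', hZ'app⟩ := exists_discretization (H.lt (j + 1) (by omega))
      (H.compl (j + 1) (by omega)) ((Finset.range (m + 1)).biUnion Z) K hhpos
    have hZ'd : ∀ i, Disjoint Z' (Z i) := by
      intro i
      by_cases hi : j + 1 < i ∧ i ≤ m
      · exact hZ'F.mono_right (Finset.subset_biUnion_of_mem Z (Finset.mem_range.2 (by omega)))
      · rw [hZ0 i hi]
        exact Finset.disjoint_empty_right _
    refine ⟨Function.update Z (j + 1) Z', Function.update w (j + 1) w', ?_, ?_, ?_, ?_, ?_⟩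
    · intro i hi
      rw [Function.update_of_ne (by omega)]
      exact hZ0 i (by omega)
    · intro i hi hi'
      by_cases hij : i = j + 1
      · subst hij
        rw [Function.update_self]
        exact ⟨hZ'I, hZ'K⟩
      · rw [Function.update_of_ne hij]
        exact hZ i (by omega) hi'
    · intro i z hz
      by_cases hij : i = j + 1
      · subst hij
        rw [Function.update_self] at hz ⊢
        exact hw' z hz
      · rw [Function.update_of_ne hij] at hz ⊢
        exact hw i z hz
    · intro i i' hii'
      by_cases hi : i = j + 1
      · subst hi
        rw [Function.update_self, Function.update_of_ne hii'.symm]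
        exact hZ'd i'
      · rw [Function.update_of_ne hi]
        by_cases hi' : i' = j + 1
        · subst hi'
          rw [Function.update_self]
          exact (hZ'd i).symm
        · rw [Function.update_of_ne hi']
          exact hZd i i' hii'
    · intro d hd x hx
      rcases d with _ | d
      · simpa [discreteIter, cauchyIter] using hε.le
      rw [discreteIter, Function.update_self, Function.update_self, cauchyIter,
        discreteIter_congr (Z' := Z) (w' := w) d (j + 1 + 1) fun i hi => by
          rw [Function.update_of_ne (by omega), Function.update_of_ne (by omega)]
          exact ⟨rfl, rfl⟩]
      have h1 := hh d (Finset.mem_range.2 (by omega)) Z' w' hZ'app x hx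
      have h2 : |∑ z ∈ Z', w' z * (discreteIter Z w d (j + 1 + 1) z / (x - z)) -
          ∑ z ∈ Z', w' z * (cauchyIter μ d (j + 2) z / (x - z))| ≤ ε / 2 := by
        rw [← Finset.sum_sub_distrib]
        calc _ ≤ ∑ z ∈ Z', w' z * (ε / (2 * (M + 1))) := by
              refine (Finset.abs_sum_le_sum_abs _ _).trans (Finset.sum_le_sum fun z hz => ?_)
              have hz' := hZ'I hz
              have h3 := happ d (by omega) z hz'
              have h4 := hdist x hx z hz'
              rw [← mul_sub, ← sub_div, abs_mul, abs_of_pos (hw' z hz), abs_div]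
              refine mul_le_mul_of_nonneg_left ?_ (hw' z hz).le
              rw [div_le_iff₀ (hδ.trans_le h4)]
              refine h3.trans ?_
              rw [mul_div_right_comm]
              exact mul_le_mul_of_nonneg_left h4 (by positivity)
          _ = (∑ z ∈ Z', w' z) * (ε / (2 * (M + 1))) := by rw [Finset.sum_mul]
          _ ≤ (M + 1) * (ε / (2 * (M + 1))) :=
              mul_le_mul_of_nonneg_right (by linarith [hZ'app.sum_le]) (by positivity)
          _ = ε / 2 := by field_simp
      have h5 := abs_sub_le (∑ z ∈ Z', w' z * (discreteIter Z w d (j + 1 + 1) z / (x - z)))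
        (∑ z ∈ Z', w' z * (cauchyIter μ d (j + 2) z / (x - z)))
        (∫ t, cauchyIter μ d (j + 1 + 1) t / (x - t) ∂μ (j + 1))
      linarith

theorem exists_approx_coeff_sign (H : MeasureChain m μ a b) {n : ℕ → ℕ} {R : Finset ℝ}
    (hR : (R : Set ℝ) ⊆ Icc (a 0) (b 0)) (hcard : R.card < ∑ j ∈ Finset.range (m + 1), n j) {ε : ℝ}
    (hε : 0 < ε) : ∃ (v : CoeffIdx m n → ℝ) (u : ℕ → ℝ → ℝ), ‖v‖ = 1 ∧ ∀ x ∈ Icc (a 0) (b 0),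
      (∀ j ≤ m, |u j x - cauchyIter μ j 1 x| ≤ ε) ∧
      0 ≤ (∑ q, v q * x ^ (q.2 : ℕ) * u q.1 x) * (Lagrange.nodal R id).eval x := by
  obtain ⟨Z, w, hZ0, hZ, hw, hZd, happ⟩ := H.exists_discreteIter (m + 1 + ∑ j ∈ Finset.range (m + 1), n j)
    m 0 (by omega) ε hε
  let D : DiscreteNikishin m (m + 1 + ∑ j ∈ Finset.range (m + 1), n j) :=
    DiscreteNikishin.mk' (Z := Z) (w := w) (by omega) (fun i => if i ≤ m then Icc (a i) (b i) else ∅)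
      (fun i => by
        split_ifs
        exacts [ordConnected_Icc, ordConnected_empty])
      (fun i => by
        split_ifs with h1 h2
        · exact H.disjoint i (by omega)
        all_goals simp)
      (fun i => by
        by_cases hi : 0 < i ∧ i ≤ m
        · rw [if_pos hi.2]
          exact (hZ i hi.1 hi.2).1
        · simp [hZ0 i hi])
      hZd (hZ0 0 (by simp)) (hZ0 (m + 1) (by simp)) (fun i h1 h2 => (hZ i h1 h2).2) hw
  have hI0 : D.I 0 = Icc (a 0) (b 0) := if_pos (e := (∅ : Set ℝ)) (Nat.zero_le m)
  obtain ⟨v, hv, hsign⟩ := DiscreteNikishin.exists_coeff_sign (D := D) le_rfl (H.lt 0 (Nat.zero_le m)).le hI0 hR hcard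
  refine ⟨v, fun j => discreteIter Z w j 1, hv, fun x hx => ⟨fun j hj => happ j (by omega) x hx, ?_⟩⟩
  have hx1 : x ∉ Z 1 := fun h => Set.disjoint_left.1 (D.disjoint_I 0) (hI0 ▸ hx) (D.subset_I 1 h)
  convert hsign x hx using 2
  refine Finset.sum_congr rfl fun q _ => ?_
  have h1 : (D.f 0 q.1).eval x = (D.A 1).eval x * discreteIter Z w q.1 1 x :=
    eval_iterPoly (Z := Z) (w := w) (Nat.zero_le (q.1 : ℕ)) hx1
  have h2 : (D.A 1).eval x ≠ 0 := eval_nodal_ne_zero hx1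
  rw [h1, mul_div_cancel_left₀ _ h2]

/-- There is a nontrivial linear form changing sign at most at prescribed points. -/
theorem exists_coeff_sign (H : MeasureChain m μ a b) {n : ℕ → ℕ} {R : Finset ℝ}
    (hR : (R : Set ℝ) ⊆ Icc (a 0) (b 0)) (hcard : R.card < ∑ j ∈ Finset.range (m + 1), n j) :
    ∃ v : CoeffIdx m n → ℝ, v ≠ 0 ∧ ∀ x ∈ Icc (a 0) (b 0),
      0 ≤ (∑ q, v q * x ^ (q.2 : ℕ) * cauchyIter μ q.1 1 x) * (Lagrange.nodal R id).eval x := by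
  choose v u hv hu using fun r : ℕ => H.exists_approx_coeff_sign hR hcard (ε := 1 / ((r : ℝ) + 1))
    Nat.one_div_pos_of_nat
  obtain ⟨v₀, hv₀, φ, hφ, hlim⟩ := (isCompact_sphere (0 : CoeffIdx m n → ℝ) 1).tendsto_subseq (x := v)
    fun r => by simpa using hv r
  refine ⟨v₀, fun h => by simp [h] at hv₀, fun x hx => ?_⟩
  have hulim : ∀ j ≤ m, Tendsto (fun r => u (φ r) j x) atTop (𝓝 (cauchyIter μ j 1 x)) := by
    intro j hj
    have h1 : Tendsto (fun r => u r j x) atTop (𝓝 (cauchyIter μ j 1 x)) := by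
      rw [tendsto_iff_dist_tendsto_zero]
      refine squeeze_zero (fun _ => dist_nonneg) (fun r => ?_) tendsto_one_div_add_atTop_nhds_zero_nat
      rw [Real.dist_eq]
      exact (hu r x hx).1 j hj
    exact h1.comp hφ.tendsto_atTop
  have hsum : Tendsto (fun r => (∑ q, v (φ r) q * x ^ (q.2 : ℕ) * u (φ r) q.1 x) *
      (Lagrange.nodal R id).eval x) atTop
      (𝓝 ((∑ q, v₀ q * x ^ (q.2 : ℕ) * cauchyIter μ q.1 1 x) * (Lagrange.nodal R id).eval x)) := by
    refine (tendsto_finsetSum _ fun q _ => ?_).mul_const _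
    exact ((((continuous_apply q).tendsto _).comp hlim).mul_const _).mul (hulim q.1 (by omega))
  exact ge_of_tendsto' hsum fun r => (hu (φ r) x hx).2

theorem infinite_zeros_of_integral_eq_zero (H : MeasureChain m μ a b) {j : ℕ} (hj : j ≤ m) {f : ℝ → ℝ}
    (hf : ContinuousOn f (Icc (a j) (b j))) {e : ℝ} (he : e ≠ 0) (hsign : ∀ x ∈ Icc (a j) (b j), 0 ≤ e * f x)
    (h_int : ∫ x, f x ∂μ j = 0) : {x ∈ Icc (a j) (b j) | f x = 0}.Infinite := by
  intro hfin
  have := H.finite j hj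
  have hae := ae_mem_of_compl_eq_zero (H.compl j hj)
  refine H.infinite j hj _ hfin ?_
  have h1 : ∫ x, e * f x ∂μ j = 0 := by rw [integral_const_mul, h_int, mul_zero]
  have h2 := (integral_eq_zero_iff_of_nonneg_ae (by
    filter_upwards [hae] with x hx using hsign x hx) ((integrable_of_continuousOn isCompact_Icc
      (H.compl j hj) hf).const_mul e)).1 h1
  have h3 : ∀ᵐ x ∂μ j, x ∈ {x ∈ Icc (a j) (b j) | f x = 0} := by
    filter_upwards [hae, h2] with x hx hx2
    exact ⟨hx, (mul_eq_zero.1 hx2).resolve_left he⟩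
  exact mem_ae_iff.1 h3

theorem continuousOn_form (H : MeasureChain m μ a b) {t j : ℕ} (h : j + t ≤ m) (p : ℕ → ℝ[X]) :
    ContinuousOn (fun x => ∑ d ∈ Finset.range (t + 1), (p d).eval x * cauchyIter μ d (j + 1) x)
      (Icc (a j) (b j)) :=
  continuousOn_finsetSum _ fun d hd => (Polynomial.continuousOn _).mul
    (H.continuousOn_cauchyIter (by have := Finset.mem_range.1 hd; omega))

/-- Linear forms in the iterated Cauchy transforms with infinitely many zeros are trivial. -/
theorem eq_zero_of_infinite_zeros (H : MeasureChain m μ a b) (t : ℕ) : ∀ j, j + t = m → ∀ p : ℕ → ℝ[X],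
    {x ∈ Icc (a j) (b j) | ∑ d ∈ Finset.range (t + 1), (p d).eval x * cauchyIter μ d (j + 1) x = 0}.Infinite →
    ∀ d ≤ t, p d = 0 := by
  induction t with
  | zero =>
    intro j hj p hp d hd
    obtain rfl : d = 0 := by omega
    refine eq_zero_of_infinite_isRoot _ (hp.mono fun x hx => ?_)
    have := hx.2
    simpa [cauchyIter] using this
  | succ t ih =>
    intro j hj p hp
    have hfinite := H.finite (j + 1) (by omega)
    have hdisj := H.disjoint j (by omega)
    have hcomp := H.compl (j + 1) (by omega)
    set I := Icc (a (j + 1)) (b (j + 1)) with hI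
    set L' : ℝ → ℝ := fun x => ∑ d ∈ Finset.range (t + 1), (p (d + 1)).eval x * cauchyIter μ d (j + 2) x
      with hL'
    have hL'c : ContinuousOn L' I := H.continuousOn_form (j := j + 1) (by omega) fun d => p (d + 1)
    have hinf : {x ∈ I | L' x = 0}.Infinite := by
      intro hfin
      obtain ⟨R, hR, e, he, hsign⟩ := exists_sign_changes ordConnected_Icc hL'c
        (hfin.subset fun x hx => ⟨interior_subset hx.1, hx.2⟩)
      set V : ℝ[X] := Lagrange.nodal R id with hV
      set E := (Finset.range (t + 2)).sup fun d => (V * p d).natDegree with hE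
      obtain ⟨Y, hYsub, hYcard⟩ := hp.exists_subset_card_eq (E + 2)
      set W : ℝ[X] := Lagrange.nodal Y id with hW
      have hdegE : ∀ d < t + 2, (V * p d).natDegree ≤ E := fun d hd =>
        Finset.le_sup (f := fun d => (V * p d).natDegree) (Finset.mem_range.2 hd)
      have hYI : ∀ x ∈ I, x ∉ Y := fun x hx hxY => Set.disjoint_left.1 hdisj (hYsub hxY).1 hx
      have hWne : ∀ x ∈ I, W.eval x ≠ 0 := fun x hx => eval_nodal_ne_zero (hYI x hx)
      obtain ⟨e', he'⟩ := (sameSign_of_continuousOn (I := I) ordConnected_Icc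
        (Polynomial.continuousOn W) hWne).inv
      have he'0 : e' ≠ 0 := by
        rintro rfl
        simpa using he' (a (j + 1)) (left_mem_Icc.2 (H.lt (j + 1) (by omega)).le)
      set f : ℝ → ℝ := fun x => (W.eval x)⁻¹ * (L' x * V.eval x) with hf
      have hfc : ContinuousOn f I := ((Polynomial.continuousOn W).inv₀ hWne).mul
        (hL'c.mul (Polynomial.continuousOn V))
      set c : ℝ → ℝ := fun y => V.eval y / (derivative W).eval y with hc
      have hterm : ∀ y ∈ Y, Integrable (fun s => ∑ d ∈ Finset.range (t + 1),
          (p (d + 1)).eval y * (cauchyIter μ d (j + 2) s / (y - s))) (μ (j + 1)) ∧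
          (p 0).eval y + ∫ s, ∑ d ∈ Finset.range (t + 1),
            (p (d + 1)).eval y * (cauchyIter μ d (j + 2) s / (y - s)) ∂μ (j + 1) = 0 := by
        intro y hy
        have h_int : ∀ d ∈ Finset.range (t + 1), Integrable (fun s =>
            (p (d + 1)).eval y * (cauchyIter μ d (j + 2) s / (y - s))) (μ (j + 1)) := fun d hd => by
          refine (integrable_of_continuousOn isCompact_Icc hcomp
            ((H.continuousOn_cauchyIter (d := d) (j := j + 1) ?_).div (by fun_prop) fun s hs =>
              sub_ne_zero.2 ?_)).const_mul _
          · have := Finset.mem_range.1 hd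
            omega
          · rintro rfl
            exact hYI y hs hy
        refine ⟨integrable_finsetSum _ h_int, ?_⟩
        have h1 := (hYsub hy).2
        rw [Finset.sum_range_succ'] at h1
        rw [integral_finsetSum _ h_int, ← h1, add_comm, cauchyIter, mul_one]
        congr 1
        exact Finset.sum_congr rfl fun d _ => by rw [integral_const_mul, cauchyIter]
      have hzero : ∫ s, f s ∂μ (j + 1) = 0 := by
        have h1 : ∑ y ∈ Y, c y * ((p 0).eval y + ∫ s, ∑ d ∈ Finset.range (t + 1),
            (p (d + 1)).eval y * (cauchyIter μ d (j + 2) s / (y - s)) ∂μ (j + 1)) = 0 :=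
          Finset.sum_eq_zero fun y hy => by rw [(hterm y hy).2, mul_zero]
        simp only [mul_add, Finset.sum_add_distrib] at h1
        have h2 : ∑ y ∈ Y, c y * (p 0).eval y = 0 := by
          rw [← sum_div_derivative_eq_zero Y (B := V * p 0) (Or.inr (by
            rw [hYcard]; have := hdegE 0 (by omega); omega))]
          refine Finset.sum_congr rfl fun y _ => ?_
          rw [hc, eval_mul]
          ring
        simp only [h2, zero_add, ← integral_const_mul] at h1
        rw [← integral_finsetSum _ fun y hy => (hterm y hy).1.const_mul _] at h1
        rw [← neg_eq_zero, ← integral_neg, ← h1]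
        refine integral_congr_ae ?_
        filter_upwards [ae_mem_of_compl_eq_zero hcomp] with s hs
        have h3 : ∀ d ∈ Finset.range (t + 1), ∑ y ∈ Y, c y * (p (d + 1)).eval y / (y - s) =
            - ((V * p (d + 1)).eval s / W.eval s) := by
          intro d hd
          have hpf := partial_fraction (K := ℝ) Y (B := V * p (d + 1)) (z := s) (by
            rw [hYcard]
            refine degree_le_natDegree.trans_lt ?_
            have := hdegE (d + 1) (by have := Finset.mem_range.1 hd; omega)
            exact_mod_cast (by omega))
            (fun ζ hζ => sub_ne_zero.2 (by rintro rfl; exact hYI _ hs hζ))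
          simp only [coe_aeval_eq_eval, Algebra.algebraMap_self, RingHom.id_apply] at hpf
          rw [hpf, mul_div_cancel_left₀ _ (hWne s hs), ← Finset.sum_neg_distrib]
          refine Finset.sum_congr rfl fun y hy => ?_
          rw [hc, eval_mul, ← neg_sub s y, div_neg]
          ring
        simp only [Finset.mul_sum]
        rw [Finset.sum_comm]
        have h4 : ∀ d ∈ Finset.range (t + 1), ∑ y ∈ Y, c y * ((p (d + 1)).eval y *
            (cauchyIter μ d (j + 2) s / (y - s))) =
            - ((V * p (d + 1)).eval s / W.eval s) * cauchyIter μ d (j + 2) s := by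
          intro d hd
          rw [← h3 d hd, Finset.sum_mul]
          exact Finset.sum_congr rfl fun y _ => by ring
        rw [Finset.sum_congr rfl h4, hf, hL']
        simp only [Finset.sum_mul, Finset.mul_sum, ← Finset.sum_neg_distrib, eval_mul]
        exact Finset.sum_congr rfl fun d _ => by ring
      refine H.infinite_zeros_of_integral_eq_zero (by omega) hfc (mul_ne_zero he'0 he) (fun x hx => ?_) hzero
        ((hfin.union R.finite_toSet).subset fun x hx => ?_)
      · have := mul_nonneg (he' x hx).le (hsign x hx)
        rw [hf]
        linarith
      · rcases mul_eq_zero.1 ((mul_eq_zero.1 hx.2).resolve_left (inv_ne_zero (hWne x hx.1))) with h | h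
        · exact Or.inl ⟨hx.1, h⟩
        · refine Or.inr ?_
          by_contra hxR
          exact eval_nodal_ne_zero hxR h
    have hrest := ih (j + 1) (by omega) (fun d => p (d + 1)) hinf
    have hp0 : p 0 = 0 := by
      refine eq_zero_of_infinite_isRoot _ (hp.mono fun x hx => ?_)
      have h1 := hx.2
      rw [Finset.sum_range_succ', Finset.sum_eq_zero fun d hd => by
        rw [hrest d (Nat.lt_succ_iff.1 (Finset.mem_range.1 hd)), eval_zero, zero_mul]] at h1
      simpa [cauchyIter] using h1
    intro d hd
    rcases d with _ | d
    · exact hp0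
    · exact hrest d (by omega)

/-- A multiple orthogonal polynomial of minimal degree has simple zeros, all of them in the interior of
the first interval. -/
theorem exists_eq_C_mul_nodal (H : MeasureChain m μ a b) {n : ℕ → ℕ} {Q : ℝ[X]} (hQ : Q ≠ 0)
    (hdeg : Q.natDegree ≤ ∑ j ∈ Finset.range (m + 1), n j)
    (horth : ∀ k ≤ m, ∀ i < n k, ∫ x, Q.eval x * x ^ i * cauchyIter μ k 1 x ∂μ 0 = 0) :
    ∃ R : Finset ℝ, (R : Set ℝ) ⊆ interior (Icc (a 0) (b 0)) ∧ R.card = ∑ j ∈ Finset.range (m + 1), n j ∧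
      ∃ c ≠ 0, Q = C c * Lagrange.nodal R id := by
  have := H.finite 0 (Nat.zero_le m)
  have hrootfin : ∀ S : Set ℝ, {x ∈ S | Q.eval x = 0}.Finite := fun S =>
    Q.roots.toFinset.finite_toSet.subset fun x hx => by simpa [hQ] using hx.2
  obtain ⟨R, hR, e, he, hsign⟩ := exists_sign_changes (ordConnected_Icc (a := a 0) (b := b 0))
    (Polynomial.continuousOn Q) (hrootfin _)
  have hRQ : ∀ x ∈ R, Q.eval x = 0 := fun x hx => (hR hx).2
  have hRI : (R : Set ℝ) ⊆ interior (Icc (a 0) (b 0)) := fun x hx => (hR hx).1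
  have hcard : ∑ j ∈ Finset.range (m + 1), n j ≤ R.card := by
    by_contra! hlt
    obtain ⟨v, hv, hvsign⟩ := H.exists_coeff_sign (hRI.trans interior_subset) hlt
    set L : ℝ → ℝ := fun x => ∑ d ∈ Finset.range (m + 1), (toPoly v d).eval x * cauchyIter μ d (0 + 1) x
      with hL
    have hLc : ContinuousOn L (Icc (a 0) (b 0)) := H.continuousOn_form (by omega) _
    have hLv : ∀ x, L x = ∑ q, v q * x ^ (q.2 : ℕ) * cauchyIter μ q.1 1 x := fun x =>
      sum_toPoly_eval_mul v (fun d => cauchyIter μ d 1 x) x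
    have hzero : ∫ x, Q.eval x * L x ∂μ 0 = 0 := by
      have h1 : ∀ x, Q.eval x * L x = ∑ q : CoeffIdx m n, v q * (Q.eval x * x ^ (q.2 : ℕ) *
          cauchyIter μ q.1 1 x) := fun x => by
        rw [hLv, Finset.mul_sum]
        exact Finset.sum_congr rfl fun q _ => by ring
      simp only [h1]
      rw [integral_finsetSum]
      · refine Finset.sum_eq_zero fun q _ => ?_
        rw [integral_const_mul, horth q.1 (by omega) q.2 q.2.2, mul_zero]
      · intro q _
        refine (integrable_of_continuousOn isCompact_Icc (H.compl 0 (Nat.zero_le m))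
          (ContinuousOn.mul (by fun_prop) ?_)).const_mul _
        exact H.continuousOn_cauchyIter (by omega)
    have hsgn : ∀ x ∈ Icc (a 0) (b 0), 0 ≤ e * (Q.eval x * L x) := by
      intro x hx
      by_cases hxR : x ∈ R
      · simp [hRQ x hxR]
      · have h1 := mul_nonneg (hsign x hx) (hvsign x hx)
        rw [← hLv] at h1
        refine nonneg_of_mul_nonneg_left (b := (Lagrange.nodal R id).eval x ^ 2) ?_
          (sq_pos_of_ne_zero (eval_nodal_ne_zero hxR))
        linarith
    have hinf := H.infinite_zeros_of_integral_eq_zero (Nat.zero_le m)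
      (f := fun x => Q.eval x * L x) ((Polynomial.continuousOn Q).mul hLc) he hsgn hzero
    have hLinf : {x ∈ Icc (a 0) (b 0) | L x = 0}.Infinite := fun hfin =>
      hinf (((hrootfin _).union hfin).subset fun x hx =>
        (mul_eq_zero.1 hx.2).imp (fun h => ⟨hx.1, h⟩) fun h => ⟨hx.1, h⟩)
    exact hv (eq_zero_of_toPoly (H.eq_zero_of_infinite_zeros m 0 (zero_add m) _ hLinf))
  obtain ⟨B, hB⟩ := nodal_dvd hRQ
  have hB0 : B ≠ 0 := by
    rintro rfl
    exact hQ (by rw [hB, mul_zero])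
  have hd : Q.natDegree = R.card + B.natDegree := by
    rw [hB, natDegree_mul (Lagrange.nodal_ne_zero) hB0, Lagrange.natDegree_nodal]
  refine ⟨R, hRI, by omega, B.coeff 0, fun h => hB0 ?_, ?_⟩
  · rw [eq_C_of_natDegree_eq_zero (p := B) (by omega), h, C_0]
  · rw [← eq_C_of_natDegree_eq_zero (p := B) (by omega), mul_comm, hB]

end MeasureChain

namespace SignedM

theorem measure_compl_msupport (μ : Measure ℝ) : μ (msupport μ)ᶜ = 0 := by
  refine measure_null_of_locally_null _ fun x hx => ?_
  simp only [msupport, mem_compl_iff, mem_ofPred_eq, not_forall, not_not] at hx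
  obtain ⟨U, hU, hxU, h0⟩ := hx
  exact ⟨U, mem_nhdsWithin_of_mem_nhds (hU.mem_nhds hxU), h0⟩

/-- The sum of both parts of a signed measure. -/
def total (s : SignedM) : Measure ℝ := s.pos + s.neg

theorem total_compl_supp (s : SignedM) : s.total s.suppᶜ = 0 := by
  have h1 := measure_mono_null (compl_subset_compl.2 (subset_union_left (s := msupport s.pos)
    (t := msupport s.neg))) (measure_compl_msupport s.pos)
  have h2 := measure_mono_null (compl_subset_compl.2 (subset_union_right (s := msupport s.pos)
    (t := msupport s.neg))) (measure_compl_msupport s.neg)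
  rw [total, Measure.add_apply, supp, h1, h2, add_zero]

theorem total_ne_zero {s : SignedM} {U : Set ℝ} (hU : IsOpen U) {x : ℝ} (hx : x ∈ s.supp) (hxU : x ∈ U) :
    s.total U ≠ 0 := by
  rw [total, Measure.add_apply]
  rcases hx with hx | hx
  · exact fun h => hx U hU hxU (add_eq_zero.1 h).1
  · exact fun h => hx U hU hxU (add_eq_zero.1 h).2

theorem rintegral_withDensityR {s : SignedM} [IsFiniteMeasure s.pos] [IsFiniteMeasure s.neg] {I : Set ℝ}
    (hI : IsCompact I) (hs : s.total Iᶜ = 0) {g φ : ℝ → ℝ} (hg : ContinuousOn g I) (hφ : ContinuousOn φ I) :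
    (s.withDensityR g).rintegral φ = s.rintegral fun x => φ x * g x := by
  have hpart : ∀ (ν : Measure ℝ) [IsFiniteMeasure ν], ν Iᶜ = 0 → ∀ h : ℝ → ℝ, ContinuousOn h I →
      Integrable φ (ν.withDensity fun x => ENNReal.ofReal (h x)) ∧
      ∫ x, φ x ∂ν.withDensity (fun x => ENNReal.ofReal (h x)) = ∫ x, max (h x) 0 * φ x ∂ν := by
    intro ν _ hν h hh
    have hm : AEMeasurable (fun x => ENNReal.ofReal (h x)) ν :=
      (integrable_of_continuousOn hI hν hh).aestronglyMeasurable.aemeasurable.ennreal_ofReal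
    have hlt : ∀ᵐ x ∂ν, ENNReal.ofReal (h x) < ⊤ := Eventually.of_forall fun x => ENNReal.ofReal_lt_top
    refine ⟨(integrable_withDensity_iff_integrable_smul₀' hm hlt).2 ?_, ?_⟩
    · simp only [ENNReal.toReal_ofReal', smul_eq_mul]
      exact integrable_of_continuousOn hI hν ((hh.sup continuousOn_const).mul hφ)
    · rw [integral_withDensity_eq_integral_toReal_smul₀ hm hlt]
      simp only [ENNReal.toReal_ofReal', smul_eq_mul]
  have hsplit : ∀ (ν : Measure ℝ) [IsFiniteMeasure ν], ν Iᶜ = 0 →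
      ∫ x, φ x * g x ∂ν = ∫ x, max (g x) 0 * φ x ∂ν - ∫ x, max (-g x) 0 * φ x ∂ν := by
    intro ν _ hν
    rw [← integral_sub]
    · refine integral_congr_ae (Eventually.of_forall fun x => ?_)
      simp only
      rw [← sub_mul, max_zero_sub_max_neg_zero_eq_self, mul_comm]
    · exact integrable_of_continuousOn hI hν ((hg.sup continuousOn_const).mul hφ)
    · exact integrable_of_continuousOn hI hν ((hg.neg.sup continuousOn_const).mul hφ)
  rw [total, Measure.add_apply, add_eq_zero] at hs
  have hp := hpart s.pos hs.1
  have hn := hpart s.neg hs.2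
  simp only [rintegral, withDensityR]
  rw [integral_add_measure (hp g hg).1 (hn (fun x => -g x) hg.neg).1,
    integral_add_measure (hp (fun x => -g x) hg.neg).1 (hn g hg).1, (hp g hg).2, (hn g hg).2,
    (hp (fun x => -g x) hg.neg).2, (hn (fun x => -g x) hg.neg).2, hsplit s.pos hs.1, hsplit s.neg hs.2]
  ring

theorem cauchy_ofReal (s : SignedM) (x : ℝ) : s.cauchy x = (s.cauchyR x : ℂ) := by
  simp only [cauchy, cintegral, cauchyR, rintegral, Complex.ofReal_sub, ← integral_complex_ofReal,
    Complex.ofReal_inv]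

end SignedM

namespace IsM

variable {s : SignedM} {Δ : Set ℝ}

theorem supp_subset (h : IsM s Δ) : s.supp ⊆ Δ := by
  rw [h.hullEq]
  exact subset_Icc_csInf_csSup h.compactSupp.bddBelow h.compactSupp.bddAbove

theorem total_compl (h : IsM s Δ) : s.total Δᶜ = 0 :=
  measure_mono_null (compl_subset_compl.2 h.supp_subset) s.total_compl_supp

theorem exists_sign (h : IsM s Δ) : ∃ e : ℝ, e ≠ 0 ∧ ∀ φ : ℝ → ℝ, s.rintegral φ = e * ∫ x, φ x ∂s.total := by
  rcases h.constSign with h0 | h0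
  · exact ⟨-1, by norm_num, fun φ => by simp [SignedM.rintegral, SignedM.total, h0]⟩
  · exact ⟨1, by norm_num, fun φ => by simp [SignedM.rintegral, SignedM.total, h0]⟩

end IsM

theorem MeasureChain.of_isM {m : ℕ} {σ : ℕ → SignedM} {Δ : ℕ → Set ℝ} (hσ : ∀ j ≤ m, IsM (σ j) (Δ j))
    (hdisj : ∀ j, j + 1 ≤ m → Δ j ∩ Δ (j + 1) = ∅) :
    MeasureChain m (fun j => (σ j).total) (fun j => sInf (σ j).supp) fun j => sSup (σ j).supp where
  finite j hj := by
    have := (hσ j hj).posFinite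
    have := (hσ j hj).negFinite
    simp only [SignedM.total]
    infer_instance
  lt j hj := by
    by_contra! hle
    refine (hσ j hj).infiniteSupp (Set.Finite.subset ?_ (hσ j hj).supp_subset)
    rw [(hσ j hj).hullEq]
    exact (Set.subsingleton_Icc_of_ge hle).finite
  compl j hj := by
    rw [← (hσ j hj).hullEq]
    exact (hσ j hj).total_compl
  disjoint j hj := by
    rw [← (hσ j hj.le).hullEq, ← (hσ (j + 1) hj).hullEq]
    exact Set.disjoint_iff_inter_eq_empty.2 (hdisj j hj)
  infinite j hj F hF := by
    obtain ⟨x, hx, hxF⟩ := ((hσ j hj).infiniteSupp.sdiff hF).nonempty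
    exact SignedM.total_ne_zero hF.isClosed.isOpen_compl hx hxF

/-- The measures of a Nikishin system have densities given by iterated Cauchy transforms. -/
theorem exists_rintegral_nikSys {m : ℕ} {σ : ℕ → SignedM} {Δ : ℕ → Set ℝ} (hσ : ∀ j ≤ m, IsM (σ j) (Δ j))
    (hdisj : ∀ j, j + 1 ≤ m → Δ j ∩ Δ (j + 1) = ∅) (d : ℕ) : ∀ j, j + d ≤ m →
    ∃ e : ℝ, e ≠ 0 ∧ ∀ φ : ℝ → ℝ, ContinuousOn φ (Δ j) → (nikSys σ j (j + d)).rintegral φ =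
      e * ∫ x, φ x * cauchyIter (fun j => (σ j).total) d (j + 1) x ∂(σ j).total := by
  have H := MeasureChain.of_isM hσ hdisj
  induction d with
  | zero =>
    intro j hj
    obtain ⟨e, he, h⟩ := (hσ j hj).exists_sign
    refine ⟨e, he, fun φ _ => ?_⟩
    rw [nikSys, dif_neg (by omega), h]
    simp [cauchyIter]
  | succ d ih =>
    intro j hj
    obtain ⟨e, he, h⟩ := (hσ j (by omega)).exists_sign
    obtain ⟨e', he', h'⟩ := ih (j + 1) (by omega)
    have hT : j + 1 + d = j + (d + 1) := by omega
    rw [hT] at h'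
    set T := nikSys σ (j + 1) (j + (d + 1)) with hTdef
    set u := cauchyIter (fun j => (σ j).total) (d + 1) (j + 1) with hu
    have hTu : ∀ x ∈ Δ j, T.cauchyR x = e' * u x := by
      intro x hx
      rw [SignedM.cauchyR, h', hu, cauchyIter]
      · congr 2
        ext t
        rw [div_eq_inv_mul]
      · refine ContinuousOn.inv₀ (by fun_prop) fun t ht => sub_ne_zero.2 ?_
        rintro rfl
        have : x ∈ Δ j ∩ Δ (j + 1) := ⟨hx, ht⟩
        rw [hdisj j (by omega)] at this
        exact this
    have huc : ContinuousOn u (Δ j) := by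
      rw [(hσ j (by omega)).hullEq]
      exact H.continuousOn_cauchyIter (by omega)
    have hTc : ContinuousOn T.cauchyR (Δ j) := (continuousOn_const.mul huc).congr hTu
    have := (hσ j (by omega)).posFinite
    have := (hσ j (by omega)).negFinite
    refine ⟨e * e', mul_ne_zero he he', fun φ hφ => ?_⟩
    rw [nikSys, dif_pos (by omega), SignedM.nik, SignedM.rintegral_withDensityR
      ((hσ j (by omega)).hullEq ▸ isCompact_Icc) (hσ j (by omega)).total_compl hTc hφ, h, mul_assoc]
    congr 1
    rw [← integral_const_mul]
    refine integral_congr_ae ?_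
    filter_upwards [ae_mem_of_compl_eq_zero (hσ j (by omega)).total_compl] with x hx
    rw [hTu x hx]
    ring

section Asymptotics

variable {μ : Measure ℝ} [IsFiniteMeasure μ] {a b : ℝ} {w : ℝ → ℝ}

theorem integrable_eval_mul (hμ : μ (Icc a b)ᶜ = 0) (hw : ContinuousOn w (Icc a b)) (h : ℝ[X]) :
    Integrable (fun t => h.eval t * w t) μ :=
  integrable_of_continuousOn isCompact_Icc hμ ((Polynomial.continuousOn h).mul hw)

theorem integrable_eval_mul_div (hμ : μ (Icc a b)ᶜ = 0) (hw : ContinuousOn w (Icc a b)) (h : ℝ[X]) {x : ℝ}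
    (hx : b < x) : Integrable (fun t => h.eval t * w t / (x - t)) μ :=
  integrable_of_continuousOn isCompact_Icc hμ (((Polynomial.continuousOn h).mul hw).div (by fun_prop)
    fun t ht => sub_ne_zero.2 (ht.2.trans_lt hx).ne')

theorem mul_integral_div_sub (hμ : μ (Icc a b)ᶜ = 0) (hw : ContinuousOn w (Icc a b)) (h : ℝ[X]) {x : ℝ}
    (hx : b < x) : x * ∫ t, h.eval t * w t / (x - t) ∂μ =
      ∫ t, (h * X).eval t * w t / (x - t) ∂μ + ∫ t, h.eval t * w t ∂μ := by
  rw [← integral_const_mul, ← integral_add (integrable_eval_mul_div hμ hw _ hx) (integrable_eval_mul hμ hw h)]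
  refine integral_congr_ae ?_
  filter_upwards [ae_mem_of_compl_eq_zero hμ] with t ht
  have : x - t ≠ 0 := sub_ne_zero.2 (ht.2.trans_lt hx).ne'
  rw [eval_mul, eval_X]
  field_simp
  ring

theorem exists_eval_mul_integral_eq (hμ : μ (Icc a b)ᶜ = 0) (hw : ContinuousOn w (Icc a b)) (h : ℝ[X]) :
    ∃ R : ℝ[X], ∀ x, b < x → h.eval x * ∫ t, w t / (x - t) ∂μ =
      R.eval x + ∫ t, h.eval t * w t / (x - t) ∂μ := by
  induction h using Polynomial.induction_on with
  | C c =>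
    refine ⟨0, fun x _ => ?_⟩
    simp only [eval_C, eval_zero, zero_add, mul_div_assoc, integral_const_mul]
  | add p q hp hq =>
    obtain ⟨R, hR⟩ := hp
    obtain ⟨S, hS⟩ := hq
    refine ⟨R + S, fun x hx => ?_⟩
    rw [eval_add, eval_add, add_mul, hR x hx, hS x hx, add_add_add_comm,
      ← integral_add (integrable_eval_mul_div hμ hw p hx) (integrable_eval_mul_div hμ hw q hx)]
    simp only [eval_add, add_mul, add_div]
  | monomial n c ih =>
    obtain ⟨R, hR⟩ := ih
    refine ⟨R * X + C (∫ t, (C c * X ^ n).eval t * w t ∂μ), fun x hx => ?_⟩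
    have h1 := mul_integral_div_sub hμ hw (C c * X ^ n) hx
    rw [pow_succ, ← mul_assoc, eval_mul, eval_X, mul_right_comm, hR x hx, eval_add, eval_C, eval_mul, eval_X,
      add_mul, add_assoc, mul_comm _ x, mul_comm _ x, h1, add_comm (integral _ _)]

theorem tendsto_integral_div_sub (hμ : μ (Icc a b)ᶜ = 0) (hw : ContinuousOn w (Icc a b)) (h : ℝ[X]) :
    Tendsto (fun x => ∫ t, h.eval t * w t / (x - t) ∂μ) atTop (𝓝 0) := by
  rw [← integral_zero ℝ ℝ (μ := μ)]
  refine tendsto_integral_filter_of_dominated_convergence (fun t => |h.eval t * w t|) ?_ ?_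
    (integrable_eval_mul hμ hw h).abs ?_
  · filter_upwards [eventually_gt_atTop b] with x hx
    exact (integrable_eval_mul_div hμ hw h hx).aestronglyMeasurable
  · filter_upwards [eventually_gt_atTop (b + 1)] with x hx
    filter_upwards [ae_mem_of_compl_eq_zero hμ] with t ht
    rw [Real.norm_eq_abs, abs_div]
    refine div_le_self (abs_nonneg _) ?_
    rw [le_abs]
    left
    linarith [ht.2]
  · refine Eventually.of_forall fun t => Tendsto.const_div_atTop ?_ _
    exact tendsto_atTop_add_const_right _ _ tendsto_id

theorem tendsto_sub_mul_integral_div_sub (hμ : μ (Icc a b)ᶜ = 0) (hw : ContinuousOn w (Icc a b)) (h : ℝ[X])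
    (y : ℝ) : Tendsto (fun x => (x - y) * ∫ t, h.eval t * w t / (x - t) ∂μ) atTop
      (𝓝 (∫ t, h.eval t * w t ∂μ)) := by
  have h1 := ((tendsto_integral_div_sub hμ hw (h * X)).add_const (∫ t, h.eval t * w t ∂μ)).sub
    ((tendsto_integral_div_sub hμ hw h).const_mul y)
  rw [zero_add, mul_zero, sub_zero] at h1
  refine h1.congr' ?_
  filter_upwards [eventually_gt_atTop b] with x hx
  rw [sub_mul, mul_integral_div_sub hμ hw h hx]

/-- If `Q ŝ - P` decays like `z⁻ⁿ⁻¹`, then `Q` is orthogonal to the polynomials of degree less than `n`. -/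
theorem integral_eq_zero_of_decay (hμ : μ (Icc a b)ᶜ = 0) (hw : ContinuousOn w (Icc a b)) {Q P : ℝ[X]}
    {n : ℕ} {c : ℝ} (hdecay : ∀ᶠ x in atTop, |Q.eval x * ∫ t, w t / (x - t) ∂μ - P.eval x| ≤ c / x ^ (n + 1))
    {i : ℕ} (hi : i < n) : ∫ t, Q.eval t * t ^ i * w t ∂μ = 0 := by
  obtain ⟨R, hR⟩ := exists_eval_mul_integral_eq hμ hw (Q * X ^ i)
  have hsmall : Tendsto (fun x => x * (x ^ i * (Q.eval x * ∫ t, w t / (x - t) ∂μ - P.eval x))) atTop (𝓝 0) := by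
    have h0 : Tendsto (fun x : ℝ => c / x) atTop (𝓝 0) := tendsto_const_nhds.div_atTop tendsto_id
    refine squeeze_zero_norm' ?_ h0
    filter_upwards [hdecay, eventually_ge_atTop 1] with x hx hx1
    have hx0 : 0 < x := by linarith
    have hc : 0 ≤ c := by
      have := (abs_nonneg _).trans hx
      rwa [le_div_iff₀ (by positivity), zero_mul] at this
    rw [Real.norm_eq_abs, abs_mul, abs_mul, abs_of_pos hx0, abs_of_pos (pow_pos hx0 i), ← mul_assoc, ← pow_succ']
    calc x ^ (i + 1) * |Q.eval x * ∫ t, w t / (x - t) ∂μ - P.eval x|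
        ≤ x ^ (i + 1) * (c / x ^ (n + 1)) := by gcongr
      _ ≤ x ^ (i + 1) * (c / x ^ (i + 2)) :=
          mul_le_mul_of_nonneg_left (div_le_div_of_nonneg_left hc (by positivity)
            (pow_le_pow_right₀ hx1 (by omega))) (by positivity)
      _ = c / x := by
          rw [pow_succ x (i + 1)]
          field_simp
  have hlim := tendsto_sub_mul_integral_div_sub hμ hw (Q * X ^ i) 0
  have h1 := (hsmall.sub hlim).congr' (f₂ := fun x => ((R - X ^ i * P) * X).eval x) (by
    filter_upwards [eventually_gt_atTop b] with x hx
    have := hR x hx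
    simp only [eval_mul, eval_pow, eval_X, eval_sub] at this ⊢
    linear_combination x * this)
  have h2 := (Polynomial.tendsto_nhds_iff _).1 h1
  have h3 : R - X ^ i * P = 0 := by
    by_contra h0
    have := h2.2
    rw [degree_mul, degree_X, degree_eq_natDegree h0] at this
    exact absurd this (by norm_cast)
  have h4 := h2.1
  rw [h3, zero_mul, leadingCoeff_zero, zero_sub, eq_comm, neg_eq_zero] at h4
  simpa using h4

/-- If `Q ŝ - P` tends to zero at infinity, the values of `P` at the zeros of `Q` are integrals. -/
theorem eval_eq_integral_of_decay (hμ : μ (Icc a b)ᶜ = 0) (hw : ContinuousOn w (Icc a b)) {g P : ℝ[X]} {y : ℝ}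
    (hdecay : Tendsto (fun x => ((X - C y) * g).eval x * ∫ t, w t / (x - t) ∂μ - P.eval x) atTop (𝓝 0)) :
    P.eval y = ∫ t, g.eval t * w t ∂μ := by
  obtain ⟨R, hR⟩ := exists_eval_mul_integral_eq hμ hw g
  have h1 := ((tendsto_sub_mul_integral_div_sub hμ hw g y).sub hdecay).congr'
    (f₂ := fun x => (P - (X - C y) * R).eval x) (by
      filter_upwards [eventually_gt_atTop b] with x hx
      have := hR x hx
      simp only [eval_mul, eval_C, eval_X, eval_sub] at this ⊢
      linear_combination - (x - y) * this)
  have h2 := (Polynomial.tendsto_nhds_iff _).1 h1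
  have h3 := eq_C_of_degree_le_zero h2.2
  rw [h3, leadingCoeff_C, sub_zero] at h2
  have h4 := congrArg (eval y) h3
  rw [h2.1] at h4
  simpa using h4

end Asymptotics

theorem sum_orderEmbOfFin (R : Finset ℝ) {N : ℕ} (h : R.card = N) (f : ℝ → ℝ) :
    ∑ i, f (R.orderEmbOfFin h i) = ∑ x ∈ R, f x := by
  conv_rhs => rw [← Finset.map_orderEmbOfFin_univ R h, Finset.sum_map]
  rfl

/-- The interpolatory quadrature formula at the zeros of a polynomial gains exactness from orthogonality. -/
theorem integral_eq_sum_of_orthogonal {μ : Measure ℝ} [IsFiniteMeasure μ] {a b : ℝ} {w : ℝ → ℝ}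
    (hμ : μ (Icc a b)ᶜ = 0) (hw : ContinuousOn w (Icc a b)) {Q P : ℝ[X]} {R : Finset ℝ} {c : ℝ} (hc : c ≠ 0)
    (hQ : Q = C c * Lagrange.nodal R id) {n : ℕ} (horth : ∀ i < n, ∫ t, Q.eval t * t ^ i * w t ∂μ = 0)
    (hP : ∀ g ζ, Q = (X - C ζ) * g → P.eval ζ = ∫ t, g.eval t * w t ∂μ) {p : ℝ[X]}
    (hp : p.degree < ((R.card + n : ℕ) : WithBot ℕ)) :
    ∫ t, p.eval t * w t ∂μ = ∑ ζ ∈ R, P.eval ζ / (derivative Q).eval ζ * p.eval ζ := by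
  set W : ℝ[X] := Lagrange.nodal R id with hW
  have hWm : W.Monic := Lagrange.nodal_monic
  have hWdeg : W.natDegree = R.card := Lagrange.natDegree_nodal
  set q := p /ₘ W with hq
  set r := p %ₘ W with hr
  have hpq : r + W * q = p := modByMonic_add_div p W
  have hrdeg : r.degree < R.card := by
    rw [← Lagrange.degree_nodal (s := R) (v := (id : ℝ → ℝ))]
    exact degree_modByMonic_lt p hWm
  have h_int := fun h : ℝ[X] => integrable_eval_mul hμ hw h
  have hqzero : ∫ t, (W * q).eval t * w t ∂μ = 0 := by
    by_cases hq0 : q = 0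
    · simp [hq0]
    have hqdeg : q.natDegree < n := by
      have hp0 : p ≠ 0 := by
        rintro rfl
        exact hq0 (zero_divByMonic W)
      rw [degree_eq_natDegree hp0, Nat.cast_lt] at hp
      have h1 : ¬ p.degree < W.degree := fun h => hq0 ((divByMonic_eq_zero_iff hWm).2 h)
      rw [degree_eq_natDegree hp0, degree_eq_natDegree hWm.ne_zero, Nat.cast_lt, hWdeg] at h1
      rw [natDegree_divByMonic p hWm, hWdeg]
      omega
    have h1 : ∀ t, (W * q).eval t * w t = ∑ i ∈ Finset.range n, c⁻¹ * q.coeff i * (Q.eval t * t ^ i * w t) := by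
      intro t
      rw [eval_mul, eval_eq_sum_range' hqdeg, hQ, eval_mul, eval_C, Finset.mul_sum, Finset.sum_mul]
      refine Finset.sum_congr rfl fun i _ => ?_
      field_simp
    simp only [h1]
    rw [integral_finsetSum]
    · exact Finset.sum_eq_zero fun i hi => by
        rw [integral_const_mul, horth i (Finset.mem_range.1 hi), mul_zero]
    · intro i _
      refine Integrable.const_mul ?_ _
      convert h_int (Q * X ^ i) using 3
      rw [eval_mul, eval_pow, eval_X]
  have hrval : ∀ ζ ∈ R, r.eval ζ = p.eval ζ := by
    intro ζ hζ
    rw [← hpq, eval_add, eval_mul, eval_nodal_eq_zero hζ, zero_mul, add_zero]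
  have hrint : ∫ t, r.eval t * w t ∂μ = ∑ ζ ∈ R, P.eval ζ / (derivative Q).eval ζ * p.eval ζ := by
    have h1 : ∀ t, r.eval t * w t = ∑ ζ ∈ R, r.eval ζ / (derivative W).eval ζ *
        ((Lagrange.nodal (R.erase ζ) id).eval t * w t) := by
      intro t
      conv_lhs => rw [eq_sum_nodal_erase R hrdeg]
      simp only [eval_finsetSum, Finset.sum_mul, eval_mul, eval_C, mul_assoc, hW]
    simp only [h1]
    rw [integral_finsetSum _ fun ζ _ => (h_int _).const_mul _]
    refine Finset.sum_congr rfl fun ζ hζ => ?_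
    have h2 : P.eval ζ = c * ∫ t, (Lagrange.nodal (R.erase ζ) id).eval t * w t ∂μ := by
      rw [hP (C c * Lagrange.nodal (R.erase ζ) id) ζ, ← integral_const_mul]
      · simp only [eval_mul, eval_C, mul_assoc]
      · rw [hQ, hW, Lagrange.nodal_eq_mul_nodal_erase hζ, id, mul_left_comm]
    have h3 : (derivative Q).eval ζ = c * (derivative W).eval ζ := by
      rw [hQ, derivative_C_mul, eval_mul, eval_C]
    have h4 := eval_derivative_nodal_ne_zero hζ
    rw [integral_const_mul, h2, h3, hrval ζ hζ]
    field_simp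
  rw [← hrint, ← add_zero (∫ t, r.eval t * w t ∂μ), ← hqzero, ← integral_add (h_int r) (h_int _)]
  simp only [← add_mul, ← eval_add, hpq]

/-- Corollary 2, first part (simultaneous Gauss–Jacobi quadrature): `Q_n` has exactly `|n|`
zeros, all simple and in the interior of `Co(supp σ₀)`, and with
`λ_{n,k,i} = P_{n,k}(x_i)/Q_n'(x_i)` the quadrature formula
`∫ p ds_{0,k} = Σ_i λ_{n,k,i} p(x_i)` is exact for all `deg p ≤ |n| + n_k − 1`. -/
theorem stmt11
    (m : ℕ)
    (σ : ℕ → SignedM) (Δ : ℕ → Set ℝ)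
    (hσ : ∀ j ≤ m, IsM (σ j) (Δ j))
    (hdisj : ∀ j, j + 1 ≤ m → Δ j ∩ Δ (j + 1) = ∅)
    (n : ℕ → ℕ) (N : ℕ) (hN : N = ∑ j ∈ Finset.range (m + 1), n j)
    (Q : Polynomial ℝ) (P : ℕ → Polynomial ℝ)
    (hQP : IsTypeII σ m n Q P) :
    ∃ x : Fin N → ℝ, StrictMono x ∧
      (∀ i, x i ∈ interior (Δ 0)) ∧
      (∀ i, Polynomial.eval (x i) Q = 0) ∧
      (∀ i, Polynomial.eval (x i) (Polynomial.derivative Q) ≠ 0) ∧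
      (∀ z : ℂ, aeval z Q = 0 → ∃ i, ((x i : ℝ) : ℂ) = z) ∧
      (∀ k ≤ m, ∀ p : Polynomial ℝ, p.degree < ((N + n k : ℕ) : WithBot ℕ) →
        (nikSys σ 0 k).rintegral (fun t => Polynomial.eval t p) =
          ∑ i : Fin N,
            (Polynomial.eval (x i) (P k) /
                Polynomial.eval (x i) (Polynomial.derivative Q)) *
              Polynomial.eval (x i) p) := by
  obtain ⟨hQ0, hdeg, hdecay⟩ := hQP
  subst hN
  have H := MeasureChain.of_isM hσ hdisj
  set μ : ℕ → Measure ℝ := fun j => (σ j).total with hμ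
  have hΔ := (hσ 0 (Nat.zero_le m)).hullEq
  have hfin := H.finite 0 (Nat.zero_le m)
  have hcomp := H.compl 0 (Nat.zero_le m)
  have hrep : ∀ k ≤ m, ∃ e : ℝ, e ≠ 0 ∧ ∀ φ : ℝ → ℝ, ContinuousOn φ (Δ 0) →
      (nikSys σ 0 k).rintegral φ = e * ∫ x, φ x * cauchyIter μ k 1 x ∂μ 0 := fun k hk => by
    simpa using exists_rintegral_nikSys hσ hdisj k 0 (by omega)
  choose! e he hrep using hrep
  set w : ℕ → ℝ → ℝ := fun k x => e k * cauchyIter μ k 1 x with hw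
  have hwc : ∀ k ≤ m, ContinuousOn (w k) (Icc (sInf (σ 0).supp) (sSup (σ 0).supp)) := fun k hk =>
    continuousOn_const.mul (H.continuousOn_cauchyIter (by omega))
  have hrepw : ∀ k ≤ m, ∀ φ : ℝ → ℝ, ContinuousOn φ (Δ 0) →
      (nikSys σ 0 k).rintegral φ = ∫ x, φ x * w k x ∂μ 0 := fun k hk φ hφ => by
    rw [hrep k hk φ hφ, ← integral_const_mul]
    exact integral_congr_ae (Eventually.of_forall fun x => by simp only [hw]; ring)
  have hdecayR : ∀ k ≤ m, ∃ c : ℝ, ∀ᶠ x in atTop,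
      |Q.eval x * ∫ t, w k t / (x - t) ∂μ 0 - (P k).eval x| ≤ c / x ^ (n k + 1) := by
    intro k hk
    obtain ⟨c, r, hc⟩ := hdecay k hk
    refine ⟨c, ?_⟩
    filter_upwards [eventually_ge_atTop r, eventually_gt_atTop 0, eventually_gt_atTop (sSup (σ 0).supp)]
      with x hxr hx0 hxb
    have h1 := hc x (by rwa [Complex.norm_of_nonneg hx0.le])
    have h2 : ∀ p : ℝ[X], aeval (x : ℂ) p = ((p.eval x : ℝ) : ℂ) := fun p =>
      aeval_algebraMap_apply_eq_algebraMap_eval x p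
    rw [SignedM.cauchy_ofReal, h2, h2, ← Complex.ofReal_mul, ← Complex.ofReal_sub, Complex.norm_real,
      Complex.norm_of_nonneg hx0.le, Real.norm_eq_abs, SignedM.cauchyR, hrepw k hk] at h1
    · simpa only [div_eq_inv_mul] using h1
    · rw [hΔ]
      exact ContinuousOn.inv₀ (by fun_prop) fun t ht => sub_ne_zero.2 (ht.2.trans_lt hxb).ne'
  have horth : ∀ k ≤ m, ∀ i < n k, ∫ t, Q.eval t * t ^ i * w k t ∂μ 0 = 0 := fun k hk i hi => by
    obtain ⟨c, hc⟩ := hdecayR k hk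
    exact integral_eq_zero_of_decay hcomp (hwc k hk) hc hi
  obtain ⟨R, hR, hcard, c, hc, hQR⟩ := H.exists_eq_C_mul_nodal hQ0 (natDegree_le_iff_degree_le.2 hdeg)
    fun k hk i hi => by
      have h1 := horth k hk i hi
      simp only [hw, mul_left_comm _ (e k)] at h1
      rw [integral_const_mul] at h1
      exact (mul_eq_zero.1 h1).resolve_left (he k hk)
  have hmem := Finset.orderEmbOfFin_mem R hcard
  refine ⟨R.orderEmbOfFin hcard, (R.orderEmbOfFin hcard).strictMono, fun i => ?_, fun i => ?_, fun i => ?_,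
    fun z hz => ?_, fun k hk p hp => ?_⟩
  · rw [hΔ]
    exact hR (hmem i)
  · rw [hQR, eval_mul, eval_nodal_eq_zero (hmem i), mul_zero]
  · rw [hQR, derivative_C_mul, eval_mul, eval_C]
    exact mul_ne_zero hc (eval_derivative_nodal_ne_zero (hmem i))
  · rw [hQR, map_mul, aeval_C, mul_eq_zero, Lagrange.nodal, map_prod, Finset.prod_eq_zero_iff] at hz
    obtain ⟨ζ, hζ, h0⟩ := hz.resolve_left (by simpa using hc)
    obtain ⟨i, hi⟩ : ζ ∈ Set.range (R.orderEmbOfFin hcard) := by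
      rw [Finset.range_orderEmbOfFin]
      exact hζ
    refine ⟨i, ?_⟩
    rw [hi]
    simpa [sub_eq_zero, eq_comm] using h0
  · rw [hrepw k hk _ (Polynomial.continuousOn p), sum_orderEmbOfFin R hcard fun ζ =>
      (P k).eval ζ / (derivative Q).eval ζ * p.eval ζ]
    refine integral_eq_sum_of_orthogonal hcomp (hwc k hk) hc hQR (horth k hk) (fun g ζ hg => ?_)
      (by rwa [hcard])
    refine eval_eq_integral_of_decay hcomp (hwc k hk) ?_
    obtain ⟨C', hC'⟩ := hdecayR k hk
    rw [← hg]
    exact squeeze_zero_norm' hC' (tendsto_const_nhds.div_atTop (tendsto_pow_atTop (Nat.succ_ne_zero _)))
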